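/- Let H be a geometric complete bipartite graph with n red vertices and n blue vertices. If there exists a set B of blue vertices such that the interior of the convex hull of B contains all red vertices and no blue vertex, then for every t with 2 ≤ t ≤ n, H contains a plane cycle of length 2t. -/

import Mathlib

noncomputable section

/-- Points of the plane. -/
abbrev Pt : Type := ℝ × ℝ

/-- Signed side of point `p` with respect to the oriented line through `u` and `u'`
(the usual cross-product / determinant test). -/
def sideSign (u u' p : Pt) : ℝ :=
  (u'.1 - u.1) * (p.2 - u.2) - (u'.2 - u.2) * (p.1 - u.1)

/-- `v` and `v'` lie on strictly opposite sides of the straight line through `u` and `u'`. -/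
def StrictlyOppositeSides (u u' v v' : Pt) : Prop :=
  sideSign u u' v * sideSign u u' v' < 0

/-- A set of points is in general position: no three (distinct) points of it are collinear. -/
def GenPos (P : Set Pt) : Prop :=
  ∀ a ∈ P, ∀ b ∈ P, ∀ c ∈ P, a ≠ b → a ≠ c → b ≠ c →
    ¬ Collinear ℝ ({a, b, c} : Set Pt)

/-- `γ : ZMod t → Pt` is a plane cycle of length `t` for the coloring `φ`:
a cyclic sequence of `t ≥ 3` distinct points in which cyclically consecutive points have
different colors, and in which two distinct edges meet exactly in their common endpoint
if they are cyclically consecutive, and not at all otherwise. -/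
def IsPlaneCycle (φ : Pt → ℕ) (t : ℕ) (γ : ZMod t → Pt) : Prop :=
  3 ≤ t ∧ Function.Injective γ ∧
  (∀ i : ZMod t, φ (γ i) ≠ φ (γ (i + 1))) ∧
  ∀ i j : ZMod t, i ≠ j →
    (j = i + 1 →
      segment ℝ (γ i) (γ (i + 1)) ∩ segment ℝ (γ j) (γ (j + 1)) = ({γ (i + 1)} : Set Pt)) ∧
    (j ≠ i + 1 → i ≠ j + 1 →
      segment ℝ (γ i) (γ (i + 1)) ∩ segment ℝ (γ j) (γ (j + 1)) = (∅ : Set Pt))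

/-- A cycle is non-rainbow if some color appears on two of its points. -/
def NonRainbow (φ : Pt → ℕ) (t : ℕ) (γ : ZMod t → Pt) : Prop :=
  ∃ i j : ZMod t, i ≠ j ∧ φ (γ i) = φ (γ j)

/-- A set of points is in convex position (each point is a vertex of the convex hull). -/
def ConvexPosition (s : Set Pt) : Prop :=
  ∀ p ∈ s, p ∉ convexHull ℝ (s \ {p})

/-! ### basics -/

def Gen (P : Set Pt) : Prop :=
  ∀ a ∈ P, ∀ b ∈ P, ∀ c ∈ P, a ≠ b → a ≠ c → b ≠ c → sideSign a b c ≠ 0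

lemma gen_of_genPos {P : Set Pt} (h : GenPos P) : Gen P := by
  intro a ha b hb c hc hab hac hbc h0
  apply h a ha b hb c hc hab hac hbc
  rw [collinear_iff_of_mem (p₀ := a) (by simp)]
  refine ⟨b - a, ?_⟩
  have key : ∃ t : ℝ, c = t • (b - a) + a := by
    unfold sideSign at h0
    by_cases hx : b.1 - a.1 = 0
    · have hy : b.2 - a.2 ≠ 0 := by
        intro hy
        exact hab (Prod.ext (by linarith) (by linarith))
      refine ⟨(c.2 - a.2) / (b.2 - a.2), Prod.ext ?_ ?_⟩
      · simp only [Prod.fst_add, Prod.smul_fst, Prod.fst_sub, smul_eq_mul, hx]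
        rw [hx] at h0
        have : (b.2 - a.2) * (c.1 - a.1) = 0 := by linarith
        rcases mul_eq_zero.1 this with h | h
        · exact absurd h hy
        · linarith
      · simp only [Prod.snd_add, Prod.smul_snd, Prod.snd_sub, smul_eq_mul]
        field_simp
        ring
    · refine ⟨(c.1 - a.1) / (b.1 - a.1), Prod.ext ?_ ?_⟩
      · simp only [Prod.fst_add, Prod.smul_fst, Prod.fst_sub, smul_eq_mul]
        field_simp
        ring
      · simp only [Prod.snd_add, Prod.smul_snd, Prod.snd_sub, smul_eq_mul]
        field_simp
        linarith
  intro p hp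
  simp only [Set.mem_insert_iff, Set.mem_singleton_iff] at hp
  rcases hp with rfl | rfl | rfl
  · exact ⟨0, by simp⟩
  · exact ⟨1, by simp⟩
  · obtain ⟨t, ht⟩ := key
    exact ⟨t, by rw [vadd_eq_add]; exact ht⟩

lemma ss_cyc (a b c : Pt) : sideSign a b c = sideSign b c a := by
  unfold sideSign; ring

lemma ss_swap (a b c : Pt) : sideSign a b c = - sideSign b a c := by
  unfold sideSign; ring

lemma ss_swap' (a b c : Pt) : sideSign a b c = - sideSign a c b := by
  unfold sideSign; ring

@[simp] lemma ss_left (a b : Pt) : sideSign a b a = 0 := by unfold sideSign; ring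
@[simp] lemma ss_right (a b : Pt) : sideSign a b b = 0 := by unfold sideSign; ring
@[simp] lemma ss_same (a b : Pt) : sideSign a a b = 0 := by unfold sideSign; ring

/-- affine functions on the plane -/
def Aff (f : Pt → ℝ) : Prop := ∃ A B C : ℝ, ∀ p, f p = A * p.1 + B * p.2 + C

lemma aff_ss (a b : Pt) : Aff (sideSign a b) :=
  ⟨-(b.2 - a.2), b.1 - a.1, -(b.1 - a.1) * a.2 + (b.2 - a.2) * a.1, by
    intro p; unfold sideSign; ring⟩

lemma aff_comb {f g : Pt → ℝ} (hf : Aff f) (hg : Aff g) (s t : ℝ) :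
    Aff (fun p => s * f p + t * g p) := by
  obtain ⟨A, B, C, h⟩ := hf
  obtain ⟨A', B', C', h'⟩ := hg
  exact ⟨s * A + t * A', s * B + t * B', s * C + t * C', by intro p; simp only [h, h']; ring⟩

lemma Aff.comb {f : Pt → ℝ} (hf : Aff f) {s t : ℝ} (hst : s + t = 1) (a b : Pt) :
    f (s • a + t • b) = s * f a + t * f b := by
  obtain ⟨A, B, C, h⟩ := hf
  simp only [h, Prod.fst_add, Prod.snd_add, Prod.smul_fst, Prod.smul_snd, smul_eq_mul]
  have : t = 1 - s := by linarith
  subst this; ring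

lemma Aff.three {f : Pt → ℝ} (hf : Aff f) (q a b c : Pt) (ha : f a = 0) (hb : f b = 0)
    (hc : f c = 0) (h : sideSign a b c ≠ 0) : f q = 0 := by
  have : f q * sideSign a b c =
      f a * sideSign q b c + f b * sideSign a q c + f c * sideSign a b q := by
    obtain ⟨A, B, C, h⟩ := hf
    simp only [h]; unfold sideSign; ring
  rw [ha, hb, hc] at this
  have h2 : f q * sideSign a b c = 0 := by linarith
  exact (mul_eq_zero.1 h2).resolve_right h

lemma Aff.seg_nonneg {f : Pt → ℝ} (hf : Aff f) {a b p : Pt} (hp : p ∈ segment ℝ a b)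
    (ha : 0 ≤ f a) (hb : 0 ≤ f b) : 0 ≤ f p := by
  obtain ⟨s, t, hs, ht, hst, rfl⟩ := hp
  rw [hf.comb hst]; positivity

/-- two edges meet only in common end points -/
def Good (e e' : Pt × Pt) : Prop :=
  ∀ p, p ∈ segment ℝ e.1 e.2 → p ∈ segment ℝ e'.1 e'.2 →
    (p = e.1 ∨ p = e.2) ∧ (p = e'.1 ∨ p = e'.2)

lemma Good.symm {e e' : Pt × Pt} (h : Good e e') : Good e' e :=
  fun p hp hp' => (h p hp' hp).symm

lemma endpt {P : Set Pt} (hG : Gen P) {p a b : Pt} (hp : p ∈ P) (ha : a ∈ P) (hb : b ∈ P)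
    (h : p ∈ segment ℝ a b) : p = a ∨ p = b := by
  by_contra hcon
  push Not at hcon
  obtain ⟨h1, h2⟩ := hcon
  have hab : a ≠ b := by
    rintro rfl
    rw [segment_same] at h
    exact h1 h
  apply hG a ha b hb p hp hab (Ne.symm h1) (Ne.symm h2)
  obtain ⟨s, t, hs, ht, hst, rfl⟩ := h
  rw [(aff_ss a b).comb hst]; simp

/-- if an affine function is `≤ 0` at both ends and vanishes at a point of the segment then
this point is an end or both ends are zeros. -/
lemma zero_ends {f : Pt → ℝ} (hf : Aff f) {a b p : Pt} (hp : p ∈ segment ℝ a b)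
    (ha : f a ≤ 0) (hb : f b ≤ 0) (h0 : f p = 0) : (p = a ∨ p = b) ∨ (f a = 0 ∧ f b = 0) := by
  obtain ⟨s, t, hs, ht, hst, rfl⟩ := hp
  rw [hf.comb hst] at h0
  rcases hs.eq_or_lt with rfl | hs
  · left; right
    have : t = 1 := by linarith
    subst this; simp
  rcases ht.eq_or_lt with rfl | ht
  · left; left
    have : s = 1 := by linarith
    subst this; simp
  right
  have h1 : s * f a ≤ 0 := mul_nonpos_of_nonneg_of_nonpos hs.le ha
  have h2 : t * f b ≤ 0 := mul_nonpos_of_nonneg_of_nonpos ht.le hb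
  have h3 : s * f a = 0 := by linarith
  have h4 : t * f b = 0 := by linarith
  exact ⟨(mul_eq_zero.1 h3).resolve_left hs.ne', (mul_eq_zero.1 h4).resolve_left ht.ne'⟩

lemma sepGood {P : Set Pt} (hG : Gen P) {f : Pt → ℝ} (hf : Aff f) {q : Pt} (hq : f q ≠ 0)
    {a b c d : Pt} (ha : a ∈ P) (hb : b ∈ P) (hc : c ∈ P) (hd : d ∈ P) (hab : a ≠ b)
    (hcd : c ≠ d) (fa : f a ≤ 0) (fb : f b ≤ 0) (fc : 0 ≤ f c) (fd : 0 ≤ f d)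
    (hne : ¬ ((a = c ∨ a = d) ∧ (b = c ∨ b = d))) : Good (a, b) (c, d) := by
  intro p hp hp'
  simp only at hp hp' ⊢
  have hZ : ∀ x ∈ P, ∀ y ∈ P, ∀ z ∈ P, x ≠ y → f x = 0 → f y = 0 → f z = 0 → z = x ∨ z = y := by
    intro x hx y hy z hz hxy h1 h2 h3
    by_contra hcon
    push Not at hcon
    exact hq (hf.three q x y z h1 h2 h3 (hG x hx y hy z hz hxy hcon.1.symm hcon.2.symm))
  have hf' : Aff (fun p => (-1) * f p + 0 * f p) := aff_comb hf hf _ _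
  have p1 : 0 ≤ f p := hf.seg_nonneg hp' fc fd
  have p2 := hf'.seg_nonneg hp (by linarith) (by linarith)
  have p0 : f p = 0 := by linarith
  have A := zero_ends hf hp fa fb p0
  have B := zero_ends hf' hp' (by linarith) (by linarith) (by simp [p0])
  have B' : (p = c ∨ p = d) ∨ (f c = 0 ∧ f d = 0) := by
    rcases B with h | h
    · exact Or.inl h
    · right; constructor <;> linarith [h.1, h.2]
  rcases A with A | A
  · have hpP : p ∈ P := by rcases A with rfl | rfl <;> assumption
    refine ⟨A, ?_⟩
    rcases B' with B' | B'
    · exact B'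
    · exact hZ c hc d hd p hpP hcd B'.1 B'.2 p0
  · rcases B' with B' | B'
    · have hpP : p ∈ P := by rcases B' with rfl | rfl <;> assumption
      exact ⟨hZ a ha b hb p hpP hab A.1 A.2 p0, B'⟩
    · exact absurd ⟨hZ c hc d hd a ha hcd B'.1 B'.2 A.1, hZ c hc d hd b hb hcd B'.1 B'.2 A.2⟩ hne

/-- an edge pointing out of a half plane -/
lemma outGood {P : Set Pt} (hG : Gen P) {f : Pt → ℝ} (hf : Aff f) {x s c d : Pt}
    (hs : s ∈ P) (hc : c ∈ P) (hd : d ∈ P) (fx : f x < 0) (fs : f s = 0) (fc : 0 ≤ f c)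
    (fd : 0 ≤ f d) : Good (x, s) (c, d) := by
  intro p hp hp'
  simp only at hp hp' ⊢
  have p1 : 0 ≤ f p := hf.seg_nonneg hp' fc fd
  have : p = s := by
    obtain ⟨u, t, hu, ht, hut, rfl⟩ := hp
    rw [hf.comb hut, fs] at p1
    have : u = 0 := by
      by_contra h
      have : 0 < u := lt_of_le_of_ne hu (Ne.symm h)
      nlinarith
    subst this
    have : t = 1 := by linarith
    subst this; simp
  subst this
  exact ⟨Or.inr rfl, endpt hG hs hc hd hp'⟩

/-! ### lists of edges -/

def edges (L : List Pt) : List (Pt × Pt) := L.zip L.tail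

@[simp] lemma edges_nil : edges [] = [] := rfl
@[simp] lemma edges_single (x : Pt) : edges [x] = [] := rfl
@[simp] lemma edges_cons (x y : Pt) (L : List Pt) :
    edges (x :: y :: L) = (x, y) :: edges (y :: L) := rfl

lemma edges_append (L : List Pt) (x : Pt) (L' : List Pt) :
    edges (L ++ x :: L') = edges (L ++ [x]) ++ edges (x :: L') := by
  induction L with
  | nil => simp
  | cons a L ih =>
    cases L with
    | nil => simp
    | cons b L => simpa using ih

lemma mem_of_edges {L : List Pt} {e : Pt × Pt} (h : e ∈ edges L) : e.1 ∈ L ∧ e.2 ∈ L := by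
  obtain ⟨a, b⟩ := e
  have := List.of_mem_zip h
  exact ⟨this.1, List.mem_of_mem_tail this.2⟩

lemma cycle_of_list {P : Set Pt} {φ : Pt → ℕ} {t : ℕ} (ht : 2 ≤ t) (C : List Pt)
    (hlen : C.length = 2 * t) (hnd : C.Nodup) (v : Pt) (hlast : C.getLast? = some v)
    (hgood : ∀ e ∈ edges (v :: C), ∀ e' ∈ edges (v :: C), e ≠ e' → Good e e')
    (hcol : ∀ e ∈ edges (v :: C), φ e.1 ≠ φ e.2) (hP : ∀ p ∈ C, p ∈ P) :
    ∃ γ : ZMod (2 * t) → Pt, IsPlaneCycle φ (2 * t) γ ∧ ∀ i, γ i ∈ P := by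
  haveI : NeZero (2 * t) := ⟨by omega⟩
  have hlt : ∀ i : ZMod (2 * t), i.val < C.length := fun i => by rw [hlen]; exact ZMod.val_lt i
  set γ : ZMod (2 * t) → Pt := fun i => C[i.val]'(hlt i) with hγ
  have hinj : Function.Injective γ := by
    intro i j hij
    exact ZMod.val_injective _ ((List.Nodup.getElem_inj_iff hnd).1 hij)
  have hedge : ∀ i, (γ i, γ (i + 1)) ∈ edges (v :: C) := by
    intro i
    unfold edges
    simp only [List.tail_cons]
    rw [List.mem_iff_getElem]
    haveI : Fact (1 < 2 * t) := ⟨by omega⟩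
    by_cases hi : i.val + 1 < 2 * t
    · have h1 : (i + 1).val = i.val + 1 := by
        rw [ZMod.val_add, ZMod.val_one, Nat.mod_eq_of_lt hi]
      refine ⟨i.val + 1, by simp; omega, ?_⟩
      simp [hγ, h1]
    · have hi' : i.val + 1 = 2 * t := by have := ZMod.val_lt i; omega
      have h1 : (i + 1).val = 0 := by
        rw [ZMod.val_add, ZMod.val_one, hi', Nat.mod_self]
      refine ⟨0, by simp; omega, ?_⟩
      have h2 : C[i.val]'(hlt i) = v := by
        rw [List.getLast?_eq_getElem?] at hlast
        have : C.length - 1 = i.val := by omega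
        rw [this, List.getElem?_eq_getElem (hlt i)] at hlast
        exact Option.some.inj hlast
      simp [hγ, h1, h2]
  have h2ne : (2 : ZMod (2 * t)) ≠ 0 := by
    intro h
    have h' : ((2 : ℕ) : ZMod (2 * t)) = 0 := by exact_mod_cast h
    rw [ZMod.natCast_eq_zero_iff] at h'
    have := Nat.le_of_dvd (by norm_num) h'
    omega
  refine ⟨γ, ⟨by omega, hinj, fun i => hcol _ (hedge i), ?_⟩, fun i => hP _ (List.getElem_mem _)⟩
  intro i j hij
  have hG := hgood _ (hedge i) _ (hedge j) (by
    intro h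
    exact hij (hinj (Prod.ext_iff.1 h).1))
  constructor
  · rintro rfl
    ext p
    simp only [Set.mem_inter_iff, Set.mem_singleton_iff]
    constructor
    · rintro ⟨h1, h2⟩
      obtain ⟨h3, h4⟩ := hG p h1 h2
      rcases h3 with h3 | h3
      · rcases h4 with h4 | h4
        · exact h4
        · exfalso
          simp only at h3 h4
          have := hinj (h3.symm.trans h4)
          apply h2ne
          have h5 : i + 0 = i + 2 := by rw [add_zero]; calc i = i + 1 + 1 := this
                                          _ = i + 2 := by ring
          exact (add_left_cancel h5).symm
      · exact h3
    · rintro rfl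
      exact ⟨right_mem_segment _ _ _, left_mem_segment _ _ _⟩
  · intro hj hi
    rw [Set.eq_empty_iff_forall_notMem]
    rintro p ⟨h1, h2⟩
    obtain ⟨h3, h4⟩ := hG p h1 h2
    simp only at h3 h4
    rcases h3 with h3 | h3 <;> rcases h4 with h4 | h4
    · exact hij (hinj (h3.symm.trans h4))
    · exact hi (hinj (h3.symm.trans h4))
    · exact hj (hinj (h3.symm.trans h4)).symm
    · exact hij (add_right_cancel (hinj (h3.symm.trans h4)))


/-! ### peeling paths -/

lemma exists_key {l : Pt → ℝ} (hl : Aff l) : ∃ key : Pt → Pt → ℝ, ∀ r b r' b' : Pt,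
    0 < l r → l b < 0 → 0 < l r' → l b' < 0 →
    ((key r' b' ≤ key r b ↔ 0 ≤ -l b * sideSign r' b' r + l r * sideSign r' b' b) ∧
    (key r' b' < key r b ↔ 0 < -l b * sideSign r' b' r + l r * sideSign r' b' b)) := by
  obtain ⟨A, B, C, h⟩ := hl
  let m : Pt → ℝ := fun p => B * p.1 - A * p.2
  refine ⟨fun r b => (m b * l r - m r * l b) / (l r - l b), ?_⟩
  intro r b r' b' h1 h2 h3 h4
  have d1 : 0 < l r - l b := by linarith
  have d2 : 0 < l r' - l b' := by linarith
  have D : 0 < A ^ 2 + B ^ 2 := by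
    by_contra hD
    have hA : A = 0 := by nlinarith [sq_nonneg A, sq_nonneg B]
    have hB : B = 0 := by nlinarith [sq_nonneg A, sq_nonneg B]
    rw [h] at h1 h2
    rw [hA, hB] at h1 h2
    linarith
  have key : (A ^ 2 + B ^ 2) * (-l b * sideSign r' b' r + l r * sideSign r' b' b) =
      (m b * l r - m r * l b) * (l r' - l b') - (m b' * l r' - m r' * l b') * (l r - l b) := by
    simp only [h, m]; unfold sideSign; ring
  rw [div_le_div_iff₀ d2 d1, div_lt_div_iff₀ d2 d1]
  constructor
  · rw [← mul_nonneg_iff_of_pos_left D, key, sub_nonneg]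
  · rw [← mul_pos_iff_of_pos_left D, key, sub_pos]

def PathOut (R B : Finset Pt) (y s : Pt) : Prop :=
  ∃ N : List Pt, (s :: N).Nodup ∧ (∀ p, p ∈ s :: N ↔ p ∈ R ∨ p ∈ B) ∧
    (s :: N).getLast? = some y ∧
    (∀ e ∈ edges (s :: N), ∀ e' ∈ edges (s :: N), e ≠ e' → Good e e') ∧
    (∀ e ∈ edges (s :: N), (e.1 ∈ R ∧ e.2 ∈ B) ∨ (e.1 ∈ B ∧ e.2 ∈ R))

lemma prepend {P : Set Pt} (hG : Gen P) {R B R' B' : Finset Pt} {y s x : Pt}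
    (h : PathOut R' B' y s) {f : Pt → ℝ} (hf : Aff f) (fx : f x < 0) (fs : f s = 0)
    (hR' : ∀ p ∈ R', p ∈ P ∧ 0 ≤ f p) (hB' : ∀ p ∈ B', p ∈ P ∧ 0 ≤ f p)
    (hRR : R' ⊆ R) (hBB : B' ⊆ B)
    (hun : ∀ p, (p ∈ R ∨ p ∈ B) ↔ (p = x ∨ (p ∈ R' ∨ p ∈ B')))
    (hc : (x ∈ R ∧ s ∈ B) ∨ (x ∈ B ∧ s ∈ R)) : PathOut R B y x := by
  obtain ⟨N, h1, h2, h3, h4, h5⟩ := h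
  have hPf : ∀ p ∈ s :: N, p ∈ P ∧ 0 ≤ f p := by
    intro p hp
    rcases (h2 p).1 hp with h | h
    · exact hR' p h
    · exact hB' p h
  have hg : ∀ e ∈ edges (s :: N), Good (x, s) e := by
    intro e he
    have hm := mem_of_edges he
    exact outGood hG hf (hPf s (by simp)).1 (hPf _ hm.1).1 (hPf _ hm.2).1 fx fs
      (hPf _ hm.1).2 (hPf _ hm.2).2
  refine ⟨s :: N, ?_, ?_, ?_, ?_, ?_⟩
  · rw [List.nodup_cons]
    refine ⟨fun hx => ?_, h1⟩
    have := (hPf x hx).2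
    linarith
  · intro p
    rw [hun, List.mem_cons, h2]
  · rw [List.getLast?_cons_cons]; exact h3
  · intro e he e' he' hne
    rw [edges_cons, List.mem_cons] at he he'
    rcases he with rfl | he <;> rcases he' with rfl | he'
    · exact absurd rfl hne
    · exact hg _ he'
    · exact (hg _ he).symm
    · exact h4 e he e' he' hne
  · intro e he
    rw [edges_cons, List.mem_cons] at he
    rcases he with rfl | he
    · exact hc
    · rcases h5 e he with h | h
      · exact Or.inl ⟨hRR h.1, hBB h.2⟩
      · exact Or.inr ⟨hBB h.1, hRR h.2⟩

lemma exists_min_pair (key : Pt → Pt → ℝ) {R B : Finset Pt} (hR : R.Nonempty)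
    (hB : B.Nonempty) : ∃ r ∈ R, ∃ b ∈ B, ∀ r' ∈ R, ∀ b' ∈ B, key r b ≤ key r' b' := by
  obtain ⟨q, hq, hmin⟩ := Finset.exists_min_image (R ×ˢ B) (fun q => key q.1 q.2) (hR.product hB)
  rw [Finset.mem_product] at hq
  exact ⟨q.1, hq.1, q.2, hq.2, fun r' hr' b' hb' =>
    hmin (r', b') (Finset.mem_product.2 ⟨hr', hb'⟩)⟩

section peel
variable {P : Set Pt} {l : Pt → ℝ} {key : Pt → Pt → ℝ}

lemma min_pair_side
    (hk : ∀ r b r' b' : Pt, 0 < l r → l b < 0 → 0 < l r' → l b' < 0 →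
      ((key r' b' ≤ key r b ↔ 0 ≤ -l b * sideSign r' b' r + l r * sideSign r' b' b) ∧
      (key r' b' < key r b ↔ 0 < -l b * sideSign r' b' r + l r * sideSign r' b' b)))
    {R B : Finset Pt} (hR : ∀ p ∈ R, 0 < l p) (hB : ∀ p ∈ B, l p < 0) {r b : Pt} (hr : r ∈ R)
    (hb : b ∈ B) (hmin : ∀ r' ∈ R, ∀ b' ∈ B, key r b ≤ key r' b') :
    (∀ p ∈ R, 0 ≤ sideSign r b p) ∧ (∀ p ∈ B, 0 ≤ sideSign r b p) := by
  constructor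
  · intro p hp
    have := (hk p b r b (hR p hp) (hB b hb) (hR r hr) (hB b hb)).1.1 (hmin p hp b hb)
    simp only [ss_right, mul_zero, add_zero] at this
    exact nonneg_of_mul_nonneg_right this (by linarith [hB b hb])
  · intro p hp
    have := (hk r p r b (hR r hr) (hB p hp) (hR r hr) (hB b hb)).1.1 (hmin r hr p hp)
    simp only [ss_left, mul_zero, zero_add] at this
    exact nonneg_of_mul_nonneg_right this (hR r hr)

lemma peel (hG : Gen P)
    (hk : ∀ r b r' b' : Pt, 0 < l r → l b < 0 → 0 < l r' → l b' < 0 →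
      ((key r' b' ≤ key r b ↔ 0 ≤ -l b * sideSign r' b' r + l r * sideSign r' b' b) ∧
      (key r' b' < key r b ↔ 0 < -l b * sideSign r' b' r + l r * sideSign r' b' b))) {y : Pt} :
    ∀ n : ℕ, ∀ R B : Finset Pt, R.card + B.card = n → (∀ p ∈ R, p ∈ P) → (∀ p ∈ B, p ∈ P) →
      (∀ p ∈ R, 0 < l p) → (∀ p ∈ B, l p < 0) → y ∈ B →
      (∀ r ∈ R, ∀ b ∈ B, b ≠ y → 0 < sideSign r b y) →
      ∀ r₀ ∈ R, ∀ b₀ ∈ B, (∀ r ∈ R, ∀ b ∈ B, key r₀ b₀ ≤ key r b) →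
      (R.card = B.card → PathOut R B y r₀) ∧ (B.card = R.card + 1 → PathOut R B y b₀) := by
  intro n
  induction n with
  | zero =>
    intro R B hn _ _ _ _ hy
    have : B.card = 0 := by omega
    rw [Finset.card_eq_zero] at this
    simp [this] at hy
  | succ n ih =>
    intro R B hn hRP hBP hRl hBl hy hys r₀ hr₀ b₀ hb₀ hmin
    have hRB : ∀ p ∈ R, ∀ q ∈ B, p ≠ q := fun p h1 q h2 h => by
      have := hRl p h1; have := hBl q h2; rw [h] at *; linarith
    have hside := min_pair_side hk hRl hBl hr₀ hb₀ hmin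
    have hR1 := Finset.card_pos.2 ⟨r₀, hr₀⟩
    have hB1 := Finset.card_pos.2 ⟨b₀, hb₀⟩
    have hK : ∀ r' ∈ R, ∀ b' ∈ B, ¬ 0 < -l b₀ * sideSign r' b' r₀ + l r₀ * sideSign r' b' b₀ := by
      intro r' hr' b' hb' h
      have := (hk r₀ b₀ r' b' (hRl _ hr₀) (hBl _ hb₀) (hRl _ hr') (hBl _ hb')).2.2 h
      linarith [hmin r' hr' b' hb']
    constructor
    · intro hcard
      have hc' := Finset.card_erase_of_mem hr₀
      by_cases hne : (R.erase r₀).Nonempty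
      · obtain ⟨r', hr', b', hb', hmin'⟩ := exists_min_pair key hne ⟨b₀, hb₀⟩
        have hr'R := Finset.mem_of_mem_erase hr'
        have hr'ne := Finset.ne_of_mem_erase hr'
        have hRl' : ∀ p ∈ R.erase r₀, 0 < l p := fun p hp => hRl p (Finset.mem_of_mem_erase hp)
        have hs' := min_pair_side hk hRl' hBl hr' hb' hmin'
        have hrec := (ih (R.erase r₀) B (by omega)
          (fun p hp => hRP p (Finset.mem_of_mem_erase hp)) hBP hRl' hBl hy
          (fun r hr => hys r (Finset.mem_of_mem_erase hr)) r' hr' b' hb' hmin').2 (by omega)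
        have hneg : sideSign r' b' r₀ < 0 := by
          by_contra hcon
          have hne0 : sideSign r' b' r₀ ≠ 0 := hG r' (hRP _ hr'R) b' (hBP _ hb') r₀ (hRP _ hr₀)
            (hRB r' hr'R b' hb') hr'ne (hRB r₀ hr₀ b' hb').symm
          have hpos : 0 < sideSign r' b' r₀ := lt_of_le_of_ne (not_lt.1 hcon) hne0.symm
          have := mul_pos (neg_pos.2 (hBl _ hb₀)) hpos
          have := mul_nonneg (hRl _ hr₀).le (hs'.2 b₀ hb₀)
          exact hK r' hr'R b' hb' (by linarith)
        refine prepend hG hrec (aff_ss r' b') hneg (ss_right _ _)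
          (fun p hp => ⟨hRP p (Finset.mem_of_mem_erase hp), hs'.1 p hp⟩)
          (fun p hp => ⟨hBP p hp, hs'.2 p hp⟩) (Finset.erase_subset _ _) (Finset.Subset.refl _)
          ?_ (Or.inl ⟨hr₀, hb'⟩)
        intro p
        rw [Finset.mem_erase]
        by_cases hp : p = r₀
        · subst hp; simp [hr₀]
        · simp [hp]
      · rw [Finset.not_nonempty_iff_eq_empty] at hne
        have h1 : R.card = 1 := by rw [hne] at hc'; simp at hc'; omega
        obtain ⟨y', hy'⟩ := Finset.card_eq_one.1 (hcard ▸ h1 : B.card = 1)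
        obtain ⟨r'', hr''⟩ := Finset.card_eq_one.1 h1
        have e1 : r'' = r₀ := by rw [hr''] at hr₀; exact (Finset.mem_singleton.1 hr₀).symm
        have e2 : y' = y := by rw [hy'] at hy; exact (Finset.mem_singleton.1 hy).symm
        subst e1 e2
        have := hRB _ hr₀ _ hy
        refine ⟨[y'], by simp [this], by simp [hr'', hy'], by simp, ?_, ?_⟩
        · intro e he e' he' hne
          simp at he he'
          exact absurd (he.trans he'.symm) hne
        · intro e he
          simp at he
          subst he
          exact Or.inl ⟨hr₀, hy⟩
    · intro hcard
      have hc' := Finset.card_erase_of_mem hb₀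
      have hby : b₀ ≠ y := by
        rintro rfl
        have : (B.erase b₀).Nonempty := Finset.card_pos.1 (by omega)
        obtain ⟨b, hb⟩ := this
        have h1 := hys r₀ hr₀ b (Finset.mem_of_mem_erase hb) (Finset.ne_of_mem_erase hb)
        have h2 := hside.2 b (Finset.mem_of_mem_erase hb)
        rw [ss_swap'] at h2
        linarith
      have hne : (B.erase b₀).Nonempty := Finset.card_pos.1 (by omega)
      obtain ⟨r', hr', b', hb', hmin'⟩ := exists_min_pair key ⟨r₀, hr₀⟩ hne
      have hb'B := Finset.mem_of_mem_erase hb'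
      have hb'ne := Finset.ne_of_mem_erase hb'
      have hBl' : ∀ p ∈ B.erase b₀, l p < 0 := fun p hp => hBl p (Finset.mem_of_mem_erase hp)
      have hs' := min_pair_side hk hRl hBl' hr' hb' hmin'
      have hrec := (ih R (B.erase b₀) (by omega) hRP
        (fun p hp => hBP p (Finset.mem_of_mem_erase hp)) hRl hBl'
        (Finset.mem_erase.2 ⟨hby.symm, hy⟩)
        (fun r hr b hb => hys r hr b (Finset.mem_of_mem_erase hb)) r' hr' b' hb' hmin').1 (by omega)
      have hneg : sideSign r' b' b₀ < 0 := by
        by_contra hcon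
        have hne0 : sideSign r' b' b₀ ≠ 0 := hG r' (hRP _ hr') b' (hBP _ hb'B) b₀ (hBP _ hb₀)
          (hRB r' hr' b' hb'B) (hRB r' hr' b₀ hb₀) hb'ne
        have hpos : 0 < sideSign r' b' b₀ := lt_of_le_of_ne (not_lt.1 hcon) hne0.symm
        have := mul_nonneg (neg_pos.2 (hBl _ hb₀)).le (hs'.1 r₀ hr₀)
        have := mul_pos (hRl _ hr₀) hpos
        exact hK r' hr' b' hb'B (by linarith)
      refine prepend hG hrec (aff_ss r' b') hneg (ss_left _ _)
        (fun p hp => ⟨hRP p hp, hs'.1 p hp⟩)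
        (fun p hp => ⟨hBP p (Finset.mem_of_mem_erase hp), hs'.2 p hp⟩)
        (Finset.Subset.refl _) (Finset.erase_subset _ _)
        ?_ (Or.inr ⟨hb₀, hr'⟩)
      intro p
      rw [Finset.mem_erase]
      by_cases hp : p = b₀
      · subst hp; simp [hb₀]
      · simp [hp]
end peel

/-- the path inside one cell -/
lemma cell {P : Set Pt} (hG : Gen P) {l : Pt → ℝ} (hl : Aff l) {R O : Finset Pt} {x y : Pt}
    (hx : x ∈ P) (hy : y ∈ P) (hRP : ∀ p ∈ R, p ∈ P) (hOP : ∀ p ∈ O, p ∈ P)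
    (hRl : ∀ p ∈ R, 0 < l p) (hOl : ∀ p ∈ O, l p < 0) (lx : l x = 0) (ly : l y = 0)
    (hcard : R.card = O.card + 1)
    (hsy : ∀ r ∈ R, ∀ b ∈ O, 0 < sideSign r b y) (hsx : ∀ r ∈ R, ∀ b ∈ O, sideSign r b x < 0)
    (hxy : ∀ r ∈ R, sideSign r y x < 0) :
    PathOut R (insert x (insert y O)) y x := by
  have hRne : R.Nonempty := Finset.card_pos.1 (by omega)
  obtain ⟨rm, hrm, hrmin⟩ := Finset.exists_min_image R l hRne
  have hθ := hRl rm hrm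
  have hl' : Aff (fun p => l p - l rm / 2) := by
    obtain ⟨A, B, C, h⟩ := hl
    exact ⟨A, B, C - l rm / 2, fun p => by show l p - _ = _; rw [h p]; ring⟩
  obtain ⟨key, hk⟩ := exists_key hl'
  have hyO : y ∉ O := fun h => by have := hOl y h; linarith
  have hyR : y ∉ R := fun h => by have := hRl y h; linarith
  obtain ⟨r₀, hr₀, b₀, hb₀, hmin⟩ := exists_min_pair key hRne (Finset.insert_nonempty y O)
  have hR' : ∀ p ∈ R, 0 < l p - l rm / 2 := fun p hp => by linarith [hrmin p hp]
  have hB' : ∀ p ∈ insert y O, l p - l rm / 2 < 0 := by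
    intro p hp
    rcases Finset.mem_insert.1 hp with rfl | h
    · linarith
    · linarith [hOl p h]
  have hBP : ∀ p ∈ insert y O, p ∈ P := by
    intro p hp
    rcases Finset.mem_insert.1 hp with rfl | h
    · exact hy
    · exact hOP p h
  have hpath := (peel hG hk (y := y) _ R (insert y O) rfl hRP hBP hR' hB' (Finset.mem_insert_self _ _)
    (by
      intro r hr b hb hby
      exact hsy r hr b ((Finset.mem_insert.1 hb).resolve_left hby)) r₀ hr₀ b₀ hb₀ hmin).1
    (by rw [Finset.card_insert_of_notMem hyO, hcard])
  have hs := min_pair_side hk hR' hB' hr₀ hb₀ hmin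
  refine prepend hG hpath (aff_ss r₀ b₀) ?_ (ss_left _ _) (fun p hp => ⟨hRP p hp, hs.1 p hp⟩)
    (fun p hp => ⟨hBP p hp, hs.2 p hp⟩) (Finset.Subset.refl _) (Finset.subset_insert _ _) ?_
    (Or.inr ⟨Finset.mem_insert_self _ _, hr₀⟩)
  · rcases Finset.mem_insert.1 hb₀ with rfl | h
    · exact hxy r₀ hr₀
    · exact hsx r₀ hr₀ b₀ h
  · intro p
    rw [Finset.mem_insert (a := p) (b := x)]
    tauto

lemma cell_single {P : Set Pt} (hG : Gen P) {r x y : Pt}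
    (hx : x ∈ P) (hy : y ∈ P) (hr : r ∈ P) (hxy : x ≠ y) (hrx : r ≠ x) (hry : r ≠ y) :
    PathOut {r} (insert x (insert y ∅)) y x := by
  have key : Good (x, r) (r, y) := by
    rcases lt_or_gt_of_ne (hG r hr y hy x hx hry hrx hxy.symm) with h | h
    · exact outGood hG (aff_ss r y) hr hr hy h (ss_left _ _) (by simp) (by simp)
    · exact outGood hG (aff_ss y r) hr hr hy (by rw [ss_swap]; linarith) (ss_right _ _)
        (by simp) (by simp)
  refine ⟨[r, y], ?_, ?_, by simp, ?_, ?_⟩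
  · simp [hxy, hrx.symm, hry]
  · intro p; simp; tauto
  · intro e he e' he' hne
    simp at he he'
    rcases he with rfl | rfl <;> rcases he' with rfl | rfl
    · exact absurd rfl hne
    · exact key
    · exact key.symm
    · exact absurd rfl hne
  · intro e he
    simp at he
    rcases he with rfl | rfl <;> simp

/-! ### optimal assignment -/

section assign
variable {T : Type} [Fintype T] [DecidableEq T] {M : ℕ}

def Alw (ε : T → ℝ) (L : Fin M → T → ℝ) (s : T) (i : Fin M) : Prop :=
  (ε s = 1 ∧ ((∀ j, 0 < L j s) ∨ (L i s < 0 ∧ ∀ j, j ≠ i → 0 < L j s))) ∨ (ε s = -1 ∧ L i s < 0)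

def Feas (ε : T → ℝ) (L : Fin M → T → ℝ) (a : T → Fin M) : Prop :=
  (∀ s, Alw ε L s (a s)) ∧ ∀ i, ∑ s, (if a s = i then ε s else 0) = 1

lemma sum_two (g : T → Fin M → ℝ) (a : T → Fin M) {s s' : T} (h : s ≠ s') (k k' : Fin M) :
    ∑ t, g t (Function.update (Function.update a s k) s' k' t) + g s (a s) + g s' (a s') =
      ∑ t, g t (a t) + g s k + g s' k' := by
  have h1 : ∀ b : T → Fin M, ∑ t, g t (b t) =
      g s (b s) + (g s' (b s') + ∑ t ∈ (Finset.univ.erase s).erase s', g t (b t)) := by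
    intro b
    rw [Finset.add_sum_erase _ (fun t => g t (b t)) (Finset.mem_erase.2 ⟨h.symm, Finset.mem_univ _⟩),
      Finset.add_sum_erase _ (fun t => g t (b t)) (Finset.mem_univ _)]
  rw [h1, h1 a]
  have h2 : ∑ t ∈ (Finset.univ.erase s).erase s',
      g t (Function.update (Function.update a s k) s' k' t) =
      ∑ t ∈ (Finset.univ.erase s).erase s', g t (a t) := by
    apply Finset.sum_congr rfl
    intro t ht
    simp only [Finset.mem_erase] at ht
    rw [Function.update_of_ne ht.1, Function.update_of_ne ht.2.1]
  rw [h2]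
  simp [Function.update_of_ne h]
  ring

lemma exchange {ε : T → ℝ} {L : Fin M → T → ℝ} {w : T → Fin M → ℝ} {a : T → Fin M}
    (ha : Feas ε L a) (hmin : ∀ b, Feas ε L b → ∑ s, w s (a s) ≤ ∑ s, w s (b s))
    {s s' : T} (h : s ≠ s') (k k' : Fin M) (hk : Alw ε L s k) (hk' : Alw ε L s' k')
    (hbal : ∀ i, (if k = i then ε s else 0) + (if k' = i then ε s' else 0) =
      (if a s = i then ε s else 0) + (if a s' = i then ε s' else 0)) :
    w s (a s) + w s' (a s') ≤ w s k + w s' k' := by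
  have hb : Feas ε L (Function.update (Function.update a s k) s' k') := by
    constructor
    · intro t
      by_cases h1 : t = s'
      · subst h1; simpa using hk'
      · rw [Function.update_of_ne h1]
        by_cases h2 : t = s
        · subst h2; simpa using hk
        · rw [Function.update_of_ne h2]; exact ha.1 t
    · intro i
      have := sum_two (fun t j => if j = i then ε t else 0) a h k k'
      have h3 := ha.2 i
      have h4 := hbal i
      linarith
  have h1 := hmin _ hb
  have h2 := sum_two w a h k k'
  linarith

lemma between (Lo Up : Finset ℝ) (hL : ∀ x ∈ Lo, 0 < x) (hU : ∀ x ∈ Up, 0 < x)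
    (h : ∀ x ∈ Lo, ∀ y ∈ Up, x ≤ y) :
    ∃ ρ : ℝ, 0 < ρ ∧ (∀ x ∈ Lo, x ≤ ρ) ∧ ∀ y ∈ Up, ρ ≤ y := by
  by_cases h1 : Lo.Nonempty
  · refine ⟨Lo.max' h1, hL _ (Finset.max'_mem _ _), fun x hx => Finset.le_max' _ _ hx,
      fun y hy => h _ (Finset.max'_mem _ _) y hy⟩
  · rw [Finset.not_nonempty_iff_eq_empty] at h1
    subst h1
    by_cases h2 : Up.Nonempty
    · exact ⟨Up.min' h2, hU _ (Finset.min'_mem _ _), by simp, fun y hy => Finset.min'_le _ _ hy⟩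
    · rw [Finset.not_nonempty_iff_eq_empty] at h2
      subst h2
      exact ⟨1, one_pos, by simp, by simp⟩

lemma sep_abs (ε : T → ℝ) (L : Fin M → T → ℝ)
    (feas : ∃ a, Feas ε L a) : ∃ a, Feas ε L a ∧ ∀ i j, i ≠ j → ∃ ρ : ℝ, 0 < ρ ∧
      (∀ s, a s = i → L i s ≤ ρ * L j s) ∧ (∀ s, a s = j → ρ * L j s ≤ L i s) := by
  classical
  let w : T → Fin M → ℝ := fun s i => ε s * Real.log (L i s)
  obtain ⟨a₀, ha₀⟩ := feas
  obtain ⟨a, ha, hmin⟩ := Finset.exists_min_image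
    (Finset.univ.filter (fun a : T → Fin M => Feas ε L a)) (fun a => ∑ s, w s (a s))
    ⟨a₀, by simpa using ha₀⟩
  simp only [Finset.mem_filter, Finset.mem_univ, true_and] at ha hmin
  refine ⟨a, ha, fun i j hij => ?_⟩
  -- candidates
  let good : T → Prop := fun s => (ε s = 1 ∧ ∀ k, 0 < L k s) ∨ (ε s = -1 ∧ L i s < 0 ∧ L j s < 0)
  have hgq : ∀ s, good s → 0 < L i s / L j s := by
    rintro s (⟨_, h⟩ | ⟨_, h1, h2⟩)
    · exact div_pos (h i) (h j)
    · exact div_pos_of_neg_of_neg h1 h2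
  have hgn : ∀ s, good s → L i s ≠ 0 ∧ L j s ≠ 0 := by
    rintro s (⟨_, h⟩ | ⟨_, h1, h2⟩)
    · exact ⟨(h i).ne', (h j).ne'⟩
    · exact ⟨h1.ne, h2.ne⟩
  have hgi : ∀ s, good s → Alw ε L s i ∧ Alw ε L s j := by
    rintro s (⟨h, h'⟩ | ⟨h, h1, h2⟩)
    · exact ⟨Or.inl ⟨h, Or.inl h'⟩, Or.inl ⟨h, Or.inl h'⟩⟩
    · exact ⟨Or.inr ⟨h, h1⟩, Or.inr ⟨h, h2⟩⟩
  let isLo : T → Prop := fun s => good s ∧ ((ε s = 1 ∧ a s = i) ∨ (ε s = -1 ∧ a s = j))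
  let isUp : T → Prop := fun s => good s ∧ ((ε s = 1 ∧ a s = j) ∨ (ε s = -1 ∧ a s = i))
  have hex : ∀ s s', isLo s → isUp s' → L i s / L j s ≤ L i s' / L j s' := by
    rintro s s' ⟨g, hs⟩ ⟨g', hs'⟩
    have hne : s ≠ s' := by
      rintro rfl
      rcases hs with ⟨h1, h2⟩ | ⟨h1, h2⟩ <;> rcases hs' with ⟨h3, h4⟩ | ⟨h3, h4⟩
      · exact hij (h2.symm.trans h4)
      · linarith
      · linarith
      · exact hij (h4.symm.trans h2)
    rw [← Real.log_le_log_iff (hgq s g) (hgq s' g'), Real.log_div (hgn s g).1 (hgn s g).2,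
      Real.log_div (hgn s' g').1 (hgn s' g').2]
    rcases hs with ⟨h1, h2⟩ | ⟨h1, h2⟩ <;> rcases hs' with ⟨h3, h4⟩ | ⟨h3, h4⟩
    · have := exchange (w := w) ha hmin hne j i (hgi s g).2 (hgi s' g').1
        (by intro k; rw [h2, h4, h1, h3]; ring)
      simp only [w, h1, h2, h3, h4] at this
      linarith
    · have := exchange (w := w) ha hmin hne j j (hgi s g).2 (hgi s' g').2
        (by intro k; rw [h2, h4, h1, h3]; split_ifs <;> ring)
      simp only [w, h1, h2, h3, h4] at this
      linarith
    · have := exchange (w := w) ha hmin hne i i (hgi s g).1 (hgi s' g').1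
        (by intro k; rw [h2, h4, h1, h3]; split_ifs <;> ring)
      simp only [w, h1, h2, h3, h4] at this
      linarith
    · have := exchange (w := w) ha hmin hne i j (hgi s g).1 (hgi s' g').2
        (by intro k; rw [h2, h4, h1, h3]; ring)
      simp only [w, h1, h2, h3, h4] at this
      linarith
  obtain ⟨ρ, hρ, hLo, hUp⟩ := between
    ((Finset.univ.filter isLo).image (fun s => L i s / L j s))
    ((Finset.univ.filter isUp).image (fun s => L i s / L j s))
    (by
      intro x hx
      simp only [Finset.mem_image, Finset.mem_filter, Finset.mem_univ, true_and] at hx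
      obtain ⟨s, hs, rfl⟩ := hx
      exact hgq s hs.1)
    (by
      intro x hx
      simp only [Finset.mem_image, Finset.mem_filter, Finset.mem_univ, true_and] at hx
      obtain ⟨s, hs, rfl⟩ := hx
      exact hgq s hs.1)
    (by
      intro x hx y hy
      simp only [Finset.mem_image, Finset.mem_filter, Finset.mem_univ, true_and] at hx hy
      obtain ⟨s, hs, rfl⟩ := hx
      obtain ⟨s', hs', rfl⟩ := hy
      exact hex s s' hs hs')
  have hLo' : ∀ s, isLo s → L i s / L j s ≤ ρ := fun s hs =>
    hLo _ (Finset.mem_image.2 ⟨s, by simpa using hs, rfl⟩)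
  have hUp' : ∀ s, isUp s → ρ ≤ L i s / L j s := fun s hs =>
    hUp _ (Finset.mem_image.2 ⟨s, by simpa using hs, rfl⟩)
  refine ⟨ρ, hρ, ?_, ?_⟩
  · intro s hs
    rcases ha.1 s with ⟨h1, h2 | ⟨h2, h3⟩⟩ | ⟨h1, h2⟩
    · have := hLo' s ⟨Or.inl ⟨h1, h2⟩, Or.inl ⟨h1, hs⟩⟩
      rwa [div_le_iff₀ (h2 j)] at this
    · rw [hs] at h2
      have := mul_pos hρ (h3 j (by rw [hs]; exact hij.symm))
      linarith
    · rw [hs] at h2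
      by_cases h3 : L j s < 0
      · have := hUp' s ⟨Or.inr ⟨h1, h2, h3⟩, Or.inr ⟨h1, hs⟩⟩
        rwa [le_div_iff_of_neg h3] at this
      · have := mul_nonneg hρ.le (not_lt.1 h3)
        linarith
  · intro s hs
    rcases ha.1 s with ⟨h1, h2 | ⟨h2, h3⟩⟩ | ⟨h1, h2⟩
    · have := hUp' s ⟨Or.inl ⟨h1, h2⟩, Or.inl ⟨h1, hs⟩⟩
      rwa [le_div_iff₀ (h2 j)] at this
    · rw [hs] at h2
      have := mul_neg_of_pos_of_neg hρ h2
      have := h3 i (by rw [hs]; exact hij)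
      linarith
    · rw [hs] at h2
      by_cases h3 : L i s < 0
      · have := hLo' s ⟨Or.inr ⟨h1, h3, h2⟩, Or.inr ⟨h1, hs⟩⟩
        rwa [div_le_iff_of_neg h2] at this
      · have := mul_neg_of_pos_of_neg hρ h2
        linarith

end assign

lemma feas_exists {M : ℕ} [NeZero M] (R O : Finset Pt) (L : Fin M → Pt → ℝ)
    (hcard : R.card = O.card + M)
    (H1 : ∀ r ∈ R, (∀ j, 0 < L j r) ∨ ∃ i, L i r < 0 ∧ ∀ j, j ≠ i → 0 < L j r)
    (H2 : ∀ i, ∀ r ∈ R, ∀ r' ∈ R, L i r < 0 → L i r' < 0 → r = r')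
    (hO : ∀ o ∈ O, ∃ i, L i o < 0) :
    ∃ a : R ⊕ O → Fin M, Feas (Sum.elim (fun _ => 1) (fun _ => -1))
      (fun i s => L i (Sum.elim Subtype.val Subtype.val s)) a := by
  classical
  choose a₀ ha₀ using fun o : O => hO o.1 o.2
  let i₀ : Fin M := 0
  let f : R → O ⊕ Fin M := fun r => if h : ∃ i, L i r < 0 then Sum.inr h.choose else Sum.inr i₀
  have hf : ∀ r : R, ∀ i, L i r < 0 → f r = Sum.inr i := by
    intro r i hi
    have hex : ∃ i, L i r < 0 := ⟨i, hi⟩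
    have : f r = Sum.inr hex.choose := dif_pos hex
    rw [this]
    congr 1
    have h1 := hex.choose_spec
    rcases H1 r r.2 with h | ⟨k, hk, h⟩
    · linarith [h i]
    · have e1 : i = k := by
        by_contra hne
        linarith [h i hne]
      have e2 : hex.choose = k := by
        by_contra hne
        linarith [h _ hne]
      rw [e1, e2]
  obtain ⟨g, hg⟩ := Finset.exists_equiv_extend_of_card_eq (α := R) (β := O ⊕ Fin M)
    (t := Finset.univ) (by simp [hcard]) (s := Finset.univ.filter (fun r : R => ∃ i, L i r < 0))
    (f := f) (Finset.subset_univ _) (by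
      intro r hr r' hr' hrr
      simp only [Finset.coe_filter, Finset.mem_univ, true_and, Set.mem_ofPred_eq] at hr hr'
      obtain ⟨i, hi⟩ := hr
      obtain ⟨i', hi'⟩ := hr'
      rw [hf r i hi, hf r' i' hi'] at hrr
      have : i = i' := Sum.inr.inj hrr
      subst this
      exact Subtype.ext (H2 i r r.2 r' r'.2 hi hi'))
  let e : R ≃ O ⊕ Fin M := g.trans ⟨fun x => x.1, fun x => ⟨x, Finset.mem_univ _⟩,
    fun x => rfl, fun x => rfl⟩
  have he : ∀ r : R, ∀ i, L i r < 0 → e r = Sum.inr i := by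
    intro r i hi
    rw [← hf r i hi]
    exact hg r (by simp; exact ⟨i, hi⟩)
  refine ⟨Sum.elim (fun r => Sum.elim a₀ id (e r)) a₀, ?_, ?_⟩
  · rintro (r | o)
    · refine Or.inl ⟨rfl, ?_⟩
      rcases H1 r r.2 with h | ⟨k, hk, h⟩
      · exact Or.inl h
      · right
        have : e r = Sum.inr k := he r k hk
        simp only [Sum.elim_inl, this, Sum.elim_inr, id]
        exact ⟨hk, h⟩
    · exact Or.inr ⟨rfl, ha₀ o⟩
  · intro i
    have h1 : ∑ r : R, (if Sum.elim a₀ id (e r) = i then (1 : ℝ) else 0) =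
        ∑ o : O, (if a₀ o = i then (1 : ℝ) else 0) + 1 := by
      rw [Equiv.sum_comp e (fun x => if Sum.elim a₀ id x = i then (1 : ℝ) else 0),
        Fintype.sum_sum_type]
      congr 1
      exact (Finset.sum_ite_eq' Finset.univ i (fun _ => (1 : ℝ))).trans (by simp)
    have h2 : ∑ o : O, (if a₀ o = i then (-1 : ℝ) else 0) =
        - ∑ o : O, (if a₀ o = i then (1 : ℝ) else 0) := by
      rw [← Finset.sum_neg_distrib]
      apply Finset.sum_congr rfl
      intro o _
      split_ifs <;> simp
    rw [Fintype.sum_sum_type]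
    refine (congrArg₂ (· + ·) h1 h2).trans ?_
    ring

lemma assign_exists {M : ℕ} [NeZero M] (R O : Finset Pt) (L : Fin M → Pt → ℝ)
    (hRO : Disjoint R O) (hcard : R.card = O.card + M)
    (H1 : ∀ r ∈ R, (∀ j, 0 < L j r) ∨ ∃ i, L i r < 0 ∧ ∀ j, j ≠ i → 0 < L j r)
    (H2 : ∀ i, ∀ r ∈ R, ∀ r' ∈ R, L i r < 0 → L i r' < 0 → r = r')
    (hO : ∀ o ∈ O, ∃ i, L i o < 0) :
    ∃ a : Pt → Fin M, (∀ o ∈ O, L (a o) o < 0) ∧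
      (∀ r ∈ R, (∀ j, 0 < L j r) ∨ (L (a r) r < 0 ∧ ∀ j, j ≠ a r → 0 < L j r)) ∧
      (∀ i, (R.filter (fun r => a r = i)).card = (O.filter (fun r => a r = i)).card + 1) ∧
      ∀ i j, i ≠ j → ∃ ρ : ℝ, 0 < ρ ∧ (∀ p, p ∈ R ∨ p ∈ O → a p = i → L i p ≤ ρ * L j p) ∧
        (∀ p, p ∈ R ∨ p ∈ O → a p = j → ρ * L j p ≤ L i p) := by
  classical
  obtain ⟨b, hb, hsep⟩ := sep_abs (T := R ⊕ O) (Sum.elim (fun _ => 1) (fun _ => -1))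
    (fun i s => L i (Sum.elim Subtype.val Subtype.val s))
    (feas_exists R O L hcard H1 H2 hO)
  let a : Pt → Fin M := fun p => if h : p ∈ R then b (Sum.inl ⟨p, h⟩) else
    if h : p ∈ O then b (Sum.inr ⟨p, h⟩) else 0
  have aR : ∀ p (h : p ∈ R), a p = b (Sum.inl ⟨p, h⟩) := fun p h => dif_pos h
  have aO : ∀ p (h : p ∈ O), a p = b (Sum.inr ⟨p, h⟩) := fun p h => by
    have : p ∉ R := fun h' => Finset.disjoint_left.1 hRO h' h
    simp only [a, this, h, dif_pos, dif_neg, not_false_eq_true]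
  refine ⟨a, ?_, ?_, ?_, ?_⟩
  · intro o ho
    rcases hb.1 (Sum.inr ⟨o, ho⟩) with h | h
    · have := h.1
      simp at this
      linarith
    · rw [aO o ho]; exact h.2
  · intro r hr
    rcases hb.1 (Sum.inl ⟨r, hr⟩) with h | h
    · rw [aR r hr]; exact h.2
    · have := h.1
      simp at this
      linarith
  · intro i
    have := hb.2 i
    rw [Fintype.sum_sum_type] at this
    simp only [Sum.elim_inl, Sum.elim_inr] at this
    have e1 : ∑ x : R, (if b (Sum.inl x) = i then (1 : ℝ) else 0) =
        ((R.filter (fun r => a r = i)).card : ℝ) := by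
      rw [Finset.card_filter]
      push_cast
      rw [← Finset.sum_coe_sort R]
      apply Finset.sum_congr rfl
      intro x _
      rw [aR x.1 x.2]
    have e2 : ∑ x : O, (if b (Sum.inr x) = i then (-1 : ℝ) else 0) =
        -((O.filter (fun r => a r = i)).card : ℝ) := by
      rw [Finset.card_filter]
      push_cast
      rw [← Finset.sum_neg_distrib, ← Finset.sum_coe_sort O]
      apply Finset.sum_congr rfl
      intro x _
      rw [aO x.1 x.2]
      split_ifs <;> simp
    rw [e1, e2] at this
    have h : ((R.filter (fun r => a r = i)).card : ℝ) =
      ((O.filter (fun r => a r = i)).card : ℝ) + 1 := by linarith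
    exact_mod_cast h
  · intro i j hij
    obtain ⟨ρ, hρ, h1, h2⟩ := hsep i j hij
    refine ⟨ρ, hρ, ?_, ?_⟩
    · rintro p (hp | hp) hi
      · rw [aR p hp] at hi; exact h1 _ hi
      · rw [aO p hp] at hi; exact h1 _ hi
    · rintro p (hp | hp) hi
      · rw [aR p hp] at hi; exact h2 _ hi
      · rw [aO p hp] at hi; exact h2 _ hi

/-! ### convex polygons -/

def CPoly (v : ℕ → Pt) (M : ℕ) : Prop :=
  Function.Periodic v M ∧ ∀ i j k, i < j → j < k → k < i + M → 0 < sideSign (v i) (v j) (v k)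

lemma per_add {v : ℕ → Pt} {M : ℕ} (h : Function.Periodic v M) (m c : ℕ) :
    v (m % M + c) = v (m + c) := by
  have hw : Function.Periodic (fun n => v (n + c)) M := by
    intro n
    show v (n + M + c) = v (n + c)
    rw [add_right_comm]; exact h _
  exact hw.map_mod_nat m

lemma per_rep {v : ℕ → Pt} {M : ℕ} (hM : 3 ≤ M) (h : Function.Periodic v M) (i k : ℕ) :
    ∃ k', i ≤ k' ∧ k' < i + M ∧ v k = v k' := by
  have h1 : v (k + i * M) = v k := h.nat_mul i k
  have h2 : i ≤ i * M := Nat.le_mul_of_pos_right _ (by omega)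
  refine ⟨(k + i * M - i) % M + i, by omega, ?_, ?_⟩
  · have := Nat.mod_lt (k + i * M - i) (show 0 < M by omega); omega
  · rw [per_add h, Nat.sub_add_cancel (by omega), h1]

namespace CPoly
variable {v : ℕ → Pt} {M : ℕ}

lemma pos (h : CPoly v M) {i k : ℕ} (h1 : i + 1 < k) (h2 : k < i + M) :
    0 < sideSign (v i) (v (i + 1)) (v k) := h.2 i (i + 1) k (by omega) h1 h2

lemma nonneg (h : CPoly v M) (hM : 3 ≤ M) (i k : ℕ) : 0 ≤ sideSign (v i) (v (i + 1)) (v k) := by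
  obtain ⟨k', h1, h2, h3⟩ := per_rep hM h.1 i k
  rw [h3]
  rcases h1.eq_or_lt with rfl | h1
  · simp
  · rcases (Nat.succ_le_of_lt h1).eq_or_lt with h4 | h4
    · have : k' = i + 1 := h4.symm
      subst this; simp
    · exact (h.pos h4 h2).le

lemma ne (h : CPoly v M) (hM : 3 ≤ M) {i j : ℕ} (h1 : i < j) (h2 : j < i + M) : v i ≠ v j := by
  intro he
  by_cases h3 : i + 1 < j
  · have := h.2 i (i + 1) j (by omega) h3 h2
    rw [he] at this; simp at this
  · have := h.2 i j (j + 1) h1 (by omega) (by omega)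
    rw [he] at this; simp at this

/-- separating points -/
lemma exists_pos (h : CPoly v M) (hM : 3 ≤ M) {i j : ℕ} (hi : i < M) (hj : j < M) (hij : i ≠ j) :
    0 < sideSign (v j) (v (j + 1)) (v i) ∨ 0 < sideSign (v j) (v (j + 1)) (v (i + 1)) := by
  have key : ∀ i', j < i' → i' < j + M → 0 < sideSign (v j) (v (j + 1)) (v i') ∨
      0 < sideSign (v j) (v (j + 1)) (v (i' + 1)) := by
    intro i' h1 h2
    by_cases h3 : j + 1 < i'
    · exact Or.inl (h.pos h3 h2)
    · exact Or.inr (h.pos (by omega) (by omega))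
  rcases lt_or_gt_of_ne hij with h1 | h1
  · have := key (i + M) (by omega) (by omega)
    rwa [h.1 i, add_right_comm, h.1 (i + 1)] at this
  · exact key i h1 (by omega)

end CPoly

lemma ratio_ineq {ρ gr hr gb hb : ℝ} (hρ : 0 < ρ) (h1 : 0 < gr) (h2 : gb < 0)
    (h3 : gr ≤ ρ * hr) (h4 : gb ≤ ρ * hb) : 0 ≤ gr * hb - hr * gb := by
  have a1 : 0 ≤ gr * (ρ * hb - gb) := mul_nonneg h1.le (by linarith)
  have a2 : 0 ≤ (ρ * hr - gr) * (-gb) := mul_nonneg (by linarith) (by linarith)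
  have a3 : 0 ≤ ρ * (gr * hb - hr * gb) := by nlinarith
  exact nonneg_of_mul_nonneg_right a3 hρ

lemma corner_next {P : Set Pt} (hG : Gen P) {p q s r b : Pt} {ρ : ℝ} (hρ : 0 < ρ)
    (hpqs : 0 < sideSign p q s) (hr : r ∈ P) (hb : b ∈ P) (hq : q ∈ P)
    (hrl : 0 < sideSign p q r) (hbl : sideSign p q b < 0)
    (h1 : sideSign p q r ≤ ρ * sideSign q s r) (h2 : sideSign p q b ≤ ρ * sideSign q s b) :
    0 < sideSign r b q := by
  have key : sideSign p q r * sideSign q s b - sideSign q s r * sideSign p q b =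
      sideSign p q s * sideSign r b q := by unfold sideSign; ring
  have h3 := ratio_ineq hρ hrl hbl h1 h2
  rw [key] at h3
  have h4 := nonneg_of_mul_nonneg_right h3 hpqs
  have hrb : r ≠ b := by rintro rfl; linarith
  have hrq : r ≠ q := by rintro rfl; simp at hrl
  have hbq : b ≠ q := by rintro rfl; simp at hbl
  exact lt_of_le_of_ne h4 (hG r hr b hb q hq hrb hrq hbq).symm

lemma corner_prev {P : Set Pt} (hG : Gen P) {p q s r b : Pt} {ρ : ℝ} (hρ : 0 < ρ)
    (hpqs : 0 < sideSign p q s) (hr : r ∈ P) (hb : b ∈ P) (hq : q ∈ P)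
    (hrl : 0 < sideSign q s r) (hbl : sideSign q s b < 0)
    (h1 : sideSign q s r ≤ ρ * sideSign p q r) (h2 : sideSign q s b ≤ ρ * sideSign p q b) :
    sideSign r b q < 0 := by
  have key : sideSign q s r * sideSign p q b - sideSign p q r * sideSign q s b =
      sideSign p q s * (- sideSign r b q) := by unfold sideSign; ring
  have h3 := ratio_ineq hρ hrl hbl h1 h2
  rw [key] at h3
  have h4 := nonneg_of_mul_nonneg_right h3 hpqs
  have hrb : r ≠ b := by rintro rfl; linarith
  have hrq : r ≠ q := by rintro rfl; simp at hrl
  have hbq : b ≠ q := by rintro rfl; simp at hbl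
  exact lt_of_le_of_ne (by linarith) (hG r hr b hb q hq hrb hrq hbq)

/-- concatenation of the cell paths -/
def cat (N : ℕ → List Pt) : ℕ → List Pt
  | 0 => []
  | k + 1 => cat N k ++ N k

lemma mem_cat {N : ℕ → List Pt} {k : ℕ} {p : Pt} : p ∈ cat N k ↔ ∃ i < k, p ∈ N i := by
  induction k with
  | zero => simp [cat]
  | succ k ih =>
    simp only [cat, List.mem_append, ih]
    constructor
    · rintro (⟨i, h1, h2⟩ | h)
      · exact ⟨i, by omega, h2⟩
      · exact ⟨k, by omega, h⟩
    · rintro ⟨i, h1, h2⟩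
      by_cases h : i = k
      · subst h; exact Or.inr h2
      · exact Or.inl ⟨i, by omega, h2⟩

lemma cat_length (N : ℕ → List Pt) (k : ℕ) :
    (cat N k).length = ∑ i ∈ Finset.range k, (N i).length := by
  induction k with
  | zero => simp [cat]
  | succ k ih => rw [Finset.sum_range_succ, ← ih]; simp [cat]

lemma cat_nodup {N : ℕ → List Pt} {k : ℕ} (h1 : ∀ i < k, (N i).Nodup)
    (h2 : ∀ i < k, ∀ j < k, i ≠ j → ∀ p ∈ N i, p ∉ N j) : (cat N k).Nodup := by
  induction k with
  | zero => simp [cat]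
  | succ k ih =>
    rw [cat, List.nodup_append']
    refine ⟨ih (fun i hi => h1 i (by omega)) (fun i hi j hj => h2 i (by omega) j (by omega)),
      h1 k (by omega), ?_⟩
    intro p hp hp'
    obtain ⟨i, hi, hpi⟩ := mem_cat.1 hp
    exact h2 i (by omega) k (by omega) (by omega) p hpi hp'

lemma cat_edges {N : ℕ → List Pt} {v : ℕ → Pt} {k : ℕ}
    (h : ∀ i < k, (v i :: N i).getLast? = some (v (i + 1))) :
    (v 0 :: cat N k).getLast? = some (v k) ∧
      ∀ e ∈ edges (v 0 :: cat N k), ∃ i < k, e ∈ edges (v i :: N i) := by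
  induction k with
  | zero => simp [cat]
  | succ k ih =>
    obtain ⟨ih1, ih2⟩ := ih (fun i hi => h i (by omega))
    obtain ⟨L, hL⟩ := List.getLast?_eq_some_iff.1 ih1
    have e1 : v 0 :: cat N (k + 1) = L ++ v k :: N k := by
      rw [cat, ← List.cons_append, hL]; simp
    rw [e1]
    constructor
    · rw [List.getLast?_append_of_ne_nil _ (by simp)]
      exact h k (by omega)
    · intro e he
      rw [edges_append, List.mem_append, ← hL] at he
      rcases he with he | he
      · obtain ⟨i, hi, hie⟩ := ih2 e he
        exact ⟨i, by omega, hie⟩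
      · exact ⟨k, by omega, he⟩

theorem core {P : Set Pt} {φ : Pt → ℕ} {red blue : ℕ} (hG : Gen P) (hrb : red ≠ blue)
    {v : ℕ → Pt} {M : ℕ} (hM : 3 ≤ M) (hv : CPoly v M) (hvP : ∀ i, v i ∈ P ∧ φ (v i) = blue)
    (R O : Finset Pt) (hRP : ∀ r ∈ R, r ∈ P ∧ φ r = red) (hOP : ∀ r ∈ O, r ∈ P ∧ φ r = blue)
    (hcard : R.card = O.card + M)
    (H1 : ∀ r ∈ R, (∀ j < M, 0 < sideSign (v j) (v (j + 1)) r) ∨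
      ∃ i < M, sideSign (v i) (v (i + 1)) r < 0 ∧
        ∀ j < M, j ≠ i → 0 < sideSign (v j) (v (j + 1)) r)
    (H2 : ∀ i < M, ∀ r ∈ R, ∀ r' ∈ R, sideSign (v i) (v (i + 1)) r < 0 →
      sideSign (v i) (v (i + 1)) r' < 0 → r = r')
    (H3 : O = ∅ ∨ ∀ r ∈ R, ∀ j < M, 0 < sideSign (v j) (v (j + 1)) r)
    (hO : ∀ o ∈ O, ∃ i < M, sideSign (v i) (v (i + 1)) o < 0) :
    ∃ γ : ZMod (2 * R.card) → Pt, IsPlaneCycle φ (2 * R.card) γ ∧ ∀ i, γ i ∈ P := by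
  classical
  have : NeZero M := ⟨by omega⟩
  have hRO : Disjoint R O := Finset.disjoint_left.2 fun p h1 h2 =>
    hrb ((hRP p h1).2.symm.trans (hOP p h2).2)
  obtain ⟨a, ha1, ha2, ha3, ha4⟩ := assign_exists (M := M) R O
    (fun i p => sideSign (v i) (v (i + 1)) p) hRO hcard
    (by
      intro r hr
      rcases H1 r hr with h | ⟨i, hi, h1, h2⟩
      · exact Or.inl fun j => h j j.2
      · exact Or.inr ⟨⟨i, hi⟩, h1, fun j hj => h2 j j.2 fun h => hj (Fin.ext h)⟩)
    (fun i r hr r' hr' => H2 i i.2 r hr r' hr')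
    (fun o ho => by
      obtain ⟨i, hi, h⟩ := hO o ho
      exact ⟨⟨i, hi⟩, h⟩)
  let RR : ℕ → Finset Pt := fun i => R.filter (fun r => (a r : ℕ) = i)
  let OO : ℕ → Finset Pt := fun i => O.filter (fun r => (a r : ℕ) = i)
  have hRR : ∀ i p, p ∈ RR i ↔ p ∈ R ∧ (a p : ℕ) = i := fun i p => by simp [RR]
  have hOO : ∀ i p, p ∈ OO i ↔ p ∈ O ∧ (a p : ℕ) = i := fun i p => by simp [OO]
  have hcardi : ∀ i < M, (RR i).card = (OO i).card + 1 := by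
    intro i hi
    have := ha3 ⟨i, hi⟩
    simpa [RR, OO, Fin.ext_iff] using this
  have hsep : ∀ i < M, ∀ j < M, i ≠ j → ∃ ρ : ℝ, 0 < ρ ∧
      (∀ p, p ∈ RR i ∨ p ∈ OO i →
        sideSign (v i) (v (i + 1)) p ≤ ρ * sideSign (v j) (v (j + 1)) p) ∧
      (∀ p, p ∈ RR j ∨ p ∈ OO j →
        ρ * sideSign (v j) (v (j + 1)) p ≤ sideSign (v i) (v (i + 1)) p) := by
    intro i hi j hj hij
    obtain ⟨ρ, hρ, h1, h2⟩ := ha4 ⟨i, hi⟩ ⟨j, hj⟩ (by simpa [Fin.ext_iff] using hij)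
    refine ⟨ρ, hρ, ?_, ?_⟩
    · intro p hp
      rw [hRR, hOO] at hp
      exact h1 p (by tauto) (Fin.ext (by tauto))
    · intro p hp
      rw [hRR, hOO] at hp
      exact h2 p (by tauto) (Fin.ext (by tauto))
  have hRvne : ∀ r ∈ R, ∀ i, r ≠ v i := by
    intro r hr i h
    exact hrb ((hRP r hr).2.symm.trans (h ▸ (hvP i).2))
  -- the paths of the cells
  have hpath : ∀ i < M, PathOut (RR i) (insert (v i) (insert (v (i + 1)) (OO i))) (v (i + 1)) (v i) := by
    intro i hi
    by_cases hin : ∀ r ∈ RR i, 0 < sideSign (v i) (v (i + 1)) r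
    · have nx : ∀ r ∈ RR i, ∀ b ∈ OO i, 0 < sideSign r b (v (i + 1)) := by
        intro r hr b hb
        have hbl : sideSign (v i) (v (i + 1)) b < 0 := by
          have := ha1 b ((hOO i b).1 hb).1
          simp only [((hOO i b).1 hb).2] at this
          exact this
        have hk : (i + 1) % M < M := Nat.mod_lt _ (by omega)
        have hik : i ≠ (i + 1) % M := by
          by_cases h : i + 1 < M
          · rw [Nat.mod_eq_of_lt h]; omega
          · have : i + 1 = M := by omega
            rw [this, Nat.mod_self]; omega
        obtain ⟨ρ, hρ, h1, h2⟩ := hsep i hi _ hk hik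
        have e0 : v ((i + 1) % M) = v (i + 1) := hv.1.map_mod_nat _
        have e1 : v ((i + 1) % M + 1) = v (i + 1 + 1) := per_add hv.1 _ _
        rw [e0, e1] at h1
        exact corner_next hG hρ (hv.pos (i := i) (k := i + 1 + 1) (by omega) (by omega))
          (hRP r ((hRR i r).1 hr).1).1 (hOP b ((hOO i b).1 hb).1).1 (hvP _).1 (hin r hr) hbl
          (h1 r (Or.inl hr)) (h1 b (Or.inr hb))
      have pv : ∀ r ∈ RR i, ∀ b ∈ OO i, sideSign r b (v i) < 0 := by
        intro r hr b hb
        have hbl : sideSign (v i) (v (i + 1)) b < 0 := by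
          have := ha1 b ((hOO i b).1 hb).1
          simp only [((hOO i b).1 hb).2] at this
          exact this
        have hk : (i + (M - 1)) % M < M := Nat.mod_lt _ (by omega)
        have hik : i ≠ (i + (M - 1)) % M := by
          by_cases h : i = 0
          · rw [Nat.mod_eq_of_lt (by omega)]; omega
          · have : i + (M - 1) = (i - 1) + M := by omega
            rw [this, Nat.add_mod_right, Nat.mod_eq_of_lt (by omega)]; omega
        obtain ⟨ρ, hρ, h1, h2⟩ := hsep i hi _ hk hik
        have e0 : v ((i + (M - 1)) % M) = v (i + (M - 1)) := hv.1.map_mod_nat _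
        have e1 : v ((i + (M - 1)) % M + 1) = v i := by
          rw [per_add hv.1, show i + (M - 1) + 1 = i + M by omega]; exact hv.1 i
        rw [e0, e1] at h1
        have hpos : 0 < sideSign (v (i + (M - 1))) (v i) (v (i + 1)) := by
          rw [ss_cyc]
          exact hv.pos (by omega) (by omega)
        exact corner_prev hG hρ hpos
          (hRP r ((hRR i r).1 hr).1).1 (hOP b ((hOO i b).1 hb).1).1 (hvP _).1 (hin r hr) hbl
          (h1 r (Or.inl hr)) (h1 b (Or.inr hb))
      refine cell hG (aff_ss (v i) (v (i + 1))) (hvP i).1 (hvP _).1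
        (fun p hp => (hRP p ((hRR i p).1 hp).1).1) (fun p hp => (hOP p ((hOO i p).1 hp).1).1)
        hin ?_ (ss_left _ _) (ss_right _ _) (hcardi i hi) nx pv ?_
      · intro b hb
        have := ha1 b ((hOO i b).1 hb).1
        simp only [((hOO i b).1 hb).2] at this
        exact this
      · intro r hr
        have e : sideSign (v i) (v (i + 1)) r = - sideSign r (v (i + 1)) (v i) := by
          unfold sideSign; ring
        have := hin r hr
        linarith
    · push Not at hin
      obtain ⟨r, hr, hneg⟩ := hin
      have hO0 : O = ∅ := by
        rcases H3 with h | h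
        · exact h
        · linarith [h r ((hRR i r).1 hr).1 i hi]
      have hOi : OO i = ∅ := by simp [OO, hO0]
      have h1 : (RR i).card = 1 := by rw [hcardi i hi, hOi]; simp
      obtain ⟨r', hr'⟩ := Finset.card_eq_one.1 h1
      have : r = r' := by rw [hr'] at hr; exact Finset.mem_singleton.1 hr
      subst this
      rw [hr', hOi]
      have hrR := ((hRR i r).1 hr).1
      exact cell_single hG (hvP _).1 (hvP _).1 (hRP r hrR).1 (hv.ne hM (by omega) (by omega))
        (hRvne r hrR _) (hRvne r hrR _)
  choose! N hN1 hN2 hN3 hN4 hN5 using hpath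
  -- membership
  have hmemN : ∀ i < M, ∀ p, p ∈ v i :: N i → (p ∈ RR i ∨ p ∈ OO i) ∨ p = v i ∨ p = v (i + 1) := by
    intro i hi p hp
    have := (hN2 i hi p).1 hp
    simp only [Finset.mem_insert] at this
    tauto
  have hTP : ∀ i < M, ∀ p, p ∈ v i :: N i → p ∈ P := by
    intro i hi p hp
    rcases hmemN i hi p hp with (h | h) | h | h
    · exact (hRP p ((hRR i p).1 h).1).1
    · exact (hOP p ((hOO i p).1 h).1).1
    · rw [h]; exact (hvP _).1
    · rw [h]; exact (hvP _).1
  have hBblue : ∀ i, ∀ p ∈ insert (v i) (insert (v (i + 1)) (OO i)), φ p = blue := by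
    intro i p hp
    simp only [Finset.mem_insert] at hp
    rcases hp with h | h | h
    · rw [h]; exact (hvP _).2
    · rw [h]; exact (hvP _).2
    · exact (hOP p ((hOO i p).1 h).1).2
  have hcolor : ∀ i < M, ∀ e ∈ edges (v i :: N i), φ e.1 ≠ φ e.2 := by
    intro i hi e he
    rcases hN5 i hi e he with ⟨h1, h2⟩ | ⟨h1, h2⟩
    · rw [(hRP _ ((hRR i _).1 h1).1).2, hBblue i _ h2]; exact hrb
    · rw [(hRP _ ((hRR i _).1 h2).1).2, hBblue i _ h1]; exact hrb.symm
  have hredcell : ∀ i < M, ∀ j < M, i ≠ j → ∀ p ∈ RR i, p ∉ v j :: N j := by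
    intro i hi j hj hij p hp hp'
    have hpR := (hRR i p).1 hp
    rcases hmemN j hj p hp' with (h | h) | h | h
    · exact hij (hpR.2.symm.trans ((hRR j p).1 h).2)
    · exact Finset.disjoint_left.1 hRO hpR.1 ((hOO j p).1 h).1
    · exact hRvne p hpR.1 _ h
    · exact hRvne p hpR.1 _ h
  have hgoodcells : ∀ i < M, ∀ j < M, i ≠ j → ∀ e ∈ edges (v i :: N i), ∀ e' ∈ edges (v j :: N j),
      Good e e' := by
    intro i hi j hj hij e he e' he'
    obtain ⟨ρ, hρ, h1, h2⟩ := hsep i hi j hj hij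
    have hm := mem_of_edges he
    have hm' := mem_of_edges he'
    have hfi : ∀ p ∈ v i :: N i,
        1 * sideSign (v i) (v (i + 1)) p + (-ρ) * sideSign (v j) (v (j + 1)) p ≤ 0 := by
      intro p hp
      rcases hmemN i hi p hp with h | h | h
      · linarith [h1 p h]
      · have := mul_nonneg hρ.le (hv.nonneg hM j i)
        rw [h]; simp; linarith
      · have := mul_nonneg hρ.le (hv.nonneg hM j (i + 1))
        rw [h]; simp; linarith
    have hfj : ∀ p ∈ v j :: N j,
        0 ≤ 1 * sideSign (v i) (v (i + 1)) p + (-ρ) * sideSign (v j) (v (j + 1)) p := by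
      intro p hp
      rcases hmemN j hj p hp with h | h | h
      · linarith [h2 p h]
      · have := hv.nonneg hM i j
        rw [h]; simp; linarith
      · have := hv.nonneg hM i (j + 1)
        rw [h]; simp; linarith
    have hq : ∃ q, 1 * sideSign (v i) (v (i + 1)) q + (-ρ) * sideSign (v j) (v (j + 1)) q ≠ 0 := by
      rcases hv.exists_pos hM hi hj hij with h | h
      · exact ⟨v i, by simp; exact ⟨hρ.ne', h.ne'⟩⟩
      · exact ⟨v (i + 1), by simp; exact ⟨hρ.ne', h.ne'⟩⟩
    obtain ⟨q, hq⟩ := hq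
    have hc := hcolor i hi e he
    have hc' := hcolor j hj e' he'
    refine sepGood (a := e.1) (b := e.2) (c := e'.1) (d := e'.2) hG
      (aff_comb (aff_ss (v i) (v (i + 1))) (aff_ss (v j) (v (j + 1))) 1 (-ρ)) hq
      (hTP i hi _ hm.1) (hTP i hi _ hm.2) (hTP j hj _ hm'.1) (hTP j hj _ hm'.2)
      (fun h => hc (by rw [h])) (fun h => hc' (by rw [h])) (hfi _ hm.1) (hfi _ hm.2)
      (hfj _ hm'.1) (hfj _ hm'.2) ?_
    rintro ⟨k1, k2⟩
    have k1' : e.1 ∈ v j :: N j := by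
      rcases k1 with k | k <;> rw [k]
      · exact hm'.1
      · exact hm'.2
    have k2' : e.2 ∈ v j :: N j := by
      rcases k2 with k | k <;> rw [k]
      · exact hm'.1
      · exact hm'.2
    rcases hN5 i hi e he with ⟨h1, _⟩ | ⟨_, h1⟩
    · exact hredcell i hi j hj hij _ h1 k1'
    · exact hredcell i hi j hj hij _ h1 k2'
  have hce := cat_edges (N := N) (v := v) (k := M) hN3
  have hlenN : ∀ i < M, (N i).length = 2 * (OO i).card + 2 := by
    intro i hi
    have e1 : (v i :: N i).toFinset = RR i ∪ insert (v i) (insert (v (i + 1)) (OO i)) := by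
      ext p
      rw [List.mem_toFinset, hN2 i hi p, Finset.mem_union]
    have e2 := List.toFinset_card_of_nodup (hN1 i hi)
    have hOv : ∀ k, v k ∉ OO i := by
      intro k hk
      have h1 := (hOO i _).1 hk
      have h2 := ha1 _ h1.1
      simp only [h1.2] at h2
      linarith [hv.nonneg hM i k]
    rw [e1, Finset.card_union_of_disjoint, Finset.card_insert_of_notMem,
      Finset.card_insert_of_notMem (hOv _), hcardi i hi] at e2
    · simp at e2; omega
    · simp only [Finset.mem_insert, not_or]
      exact ⟨hv.ne hM (by omega) (by omega), hOv i⟩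
    · rw [Finset.disjoint_left]
      intro p h1 h2
      exact hrb ((hRP p ((hRR i p).1 h1).1).2.symm.trans (hBblue i p h2))
  have hlen : (cat N M).length = 2 * R.card := by
    rw [cat_length, Finset.sum_congr rfl (fun i hi => hlenN i (Finset.mem_range.1 hi))]
    rw [Finset.sum_add_distrib, ← Finset.mul_sum]
    have : O.card = ∑ i ∈ Finset.range M, (OO i).card :=
      Finset.card_eq_sum_card_fiberwise (f := fun r => (a r : ℕ)) (s := O) (t := Finset.range M)
        (by intro p _; simp)
    rw [← this, hcard]
    simp; ring
  refine cycle_of_list (t := R.card) (by omega) (cat N M) hlen ?_ (v 0) ?_ ?_ ?_ ?_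
  · apply cat_nodup
    · intro i hi
      exact (List.nodup_cons.1 (hN1 i hi)).2
    · intro i hi j hj hij p hp hp'
      have hpi := hmemN i hi p (List.mem_cons_of_mem _ hp)
      have hpj := hmemN j hj p (List.mem_cons_of_mem _ hp')
      have hvi : p ≠ v i := fun h => (List.nodup_cons.1 (hN1 i hi)).1 (h ▸ hp)
      have hvj : p ≠ v j := fun h => (List.nodup_cons.1 (hN1 j hj)).1 (h ▸ hp')
      have hOv : ∀ k i, v k ∉ OO i := by
        intro k i hk
        have h1 := (hOO i _).1 hk
        have h2 := ha1 _ h1.1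
        linarith [hv.nonneg hM (a (v k)) k]
      rcases hpi with (h | h) | h | h
      · exact hredcell i hi j hj hij p h (List.mem_cons_of_mem _ hp')
      · rcases hpj with (h' | h') | h' | h'
        · exact hredcell j hj i hi hij.symm p h' (List.mem_cons_of_mem _ hp)
        · exact hij (((hOO i p).1 h).2.symm.trans ((hOO j p).1 h').2)
        · exact hvj h'
        · exact hOv _ _ (h' ▸ h)
      · exact hvi h
      · rcases hpj with (h' | h') | h' | h'
        · exact hredcell j hj i hi hij.symm p h' (List.mem_cons_of_mem _ hp)
        · exact hOv _ _ (h ▸ h')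
        · exact hvj h'
        · have e := h.symm.trans h'
          rcases lt_or_gt_of_ne hij with h3 | h3
          · exact hv.ne hM (i := i + 1) (j := j + 1) (by omega) (by omega) e
          · exact hv.ne hM (i := j + 1) (j := i + 1) (by omega) (by omega) e.symm
  · have h1 := hce.1
    have h0 : v M = v 0 := by simpa using hv.1 0
    rw [h0] at h1
    have hne : cat N M ≠ [] := by
      intro h
      rw [h] at hlen
      simp at hlen
      rw [hlen] at hcard
      simp at hcard
      omega
    rw [show v 0 :: cat N M = [v 0] ++ cat N M from rfl,
      List.getLast?_append_of_ne_nil _ hne] at h1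
    exact h1
  · intro e he e' he' hne
    obtain ⟨i, hi, hei⟩ := hce.2 e he
    obtain ⟨j, hj, hej⟩ := hce.2 e' he'
    by_cases hij : i = j
    · subst hij
      exact hN4 i hi e hei e' hej hne
    · exact hgoodcells i hi j hj hij e hei e' hej
  · intro e he
    obtain ⟨i, hi, hei⟩ := hce.2 e he
    exact hcolor i hi e hei
  · intro p hp
    obtain ⟨i, hi, h⟩ := mem_cat.1 hp
    exact hTP i hi p (List.mem_cons_of_mem _ h)

/-! ### convexity facts -/

lemma adjGood {P : Set Pt} (hG : Gen P) {r x y : Pt}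
    (hx : x ∈ P) (hy : y ∈ P) (hr : r ∈ P) (hxy : x ≠ y) (hrx : r ≠ x) (hry : r ≠ y) :
    Good (x, r) (r, y) := by
  rcases lt_or_gt_of_ne (hG r hr y hy x hx hry hrx hxy.symm) with h | h
  · exact outGood hG (aff_ss r y) hr hr hy h (ss_left _ _) (by simp) (by simp)
  · exact outGood hG (aff_ss y r) hr hr hy (by rw [ss_swap]; linarith) (ss_right _ _)
      (by simp) (by simp)

lemma ss_cont (a b : Pt) : Continuous (fun p : Pt => sideSign a b p) := by
  unfold sideSign; fun_prop

lemma int_ss {B : Set Pt} {r a b : Pt} (hr : r ∈ interior (convexHull ℝ B)) (hab : a ≠ b) :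
    ∃ q ∈ B, sideSign a b r < sideSign a b q := by
  by_contra hcon
  push Not at hcon
  have hsub : convexHull ℝ B ⊆ {p | sideSign a b p ≤ sideSign a b r} := by
    apply convexHull_min
    · intro q hq; exact hcon q hq
    · intro p hp q hq s t hs ht hst
      show sideSign a b (s • p + t • q) ≤ sideSign a b r
      rw [(aff_ss a b).comb hst]
      have h1 : sideSign a b p ≤ sideSign a b r := hp
      have h2 : sideSign a b q ≤ sideSign a b r := hq
      have e : sideSign a b r = s * sideSign a b r + t * sideSign a b r := by
        rw [← add_mul, hst, one_mul]
      rw [e]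
      gcongr
  have hnh := mem_interior_iff_mem_nhds.1 hr
  let w : ℝ → Pt := fun s => (r.1 - s * (b.2 - a.2), r.2 + s * (b.1 - a.1))
  have hw : Continuous w := by fun_prop
  have hw0 : w 0 = r := by simp [w]
  have hev : ∀ᶠ s in nhds (0 : ℝ), w s ∈ convexHull ℝ B := by
    apply hw.continuousAt.eventually_mem
    rw [hw0]; exact hnh
  obtain ⟨δ, hδ, hball⟩ := Metric.eventually_nhds_iff.1 hev
  have h1 := hsub (hball (y := δ / 2) (by
    rw [Real.dist_eq, sub_zero, abs_of_pos (by linarith)]; linarith))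
  have h2 : sideSign a b (w (δ / 2)) ≤ sideSign a b r := h1
  have h3 : sideSign a b (w (δ / 2)) =
      sideSign a b r + δ / 2 * ((b.1 - a.1) ^ 2 + (b.2 - a.2) ^ 2) := by
    simp only [w]; unfold sideSign; ring
  have h4 : 0 < (b.1 - a.1) ^ 2 + (b.2 - a.2) ^ 2 := by
    by_contra h
    have e1 : b.1 - a.1 = 0 := by nlinarith [sq_nonneg (b.1 - a.1), sq_nonneg (b.2 - a.2)]
    have e2 : b.2 - a.2 = 0 := by nlinarith [sq_nonneg (b.1 - a.1), sq_nonneg (b.2 - a.2)]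
    exact hab (Prod.ext (by linarith) (by linarith))
  have := mul_pos (half_pos hδ) h4
  linarith

lemma not_two {B : Set Pt} {r a b : Pt} (hr : r ∈ interior (convexHull ℝ B)) (hab : a ≠ b)
    (h : ∀ p ∈ B, p = a ∨ p = b) : False := by
  obtain ⟨q, hq, h1⟩ := int_ss hr hab
  obtain ⟨q', hq', h2⟩ := int_ss hr hab.symm
  have z1 : sideSign a b q = 0 := by rcases h q hq with rfl | rfl <;> simp
  have z2 : sideSign b a q' = 0 := by rcases h q' hq' with rfl | rfl <;> simp
  rw [z2, ss_swap] at h2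
  linarith

lemma tri_mem {B : Set Pt} {a b c p : Pt} (ha : a ∈ B) (hb : b ∈ B) (hc : c ∈ B)
    (hS : 0 < sideSign a b c) (h1 : 0 ≤ sideSign a b p) (h2 : 0 ≤ sideSign b c p)
    (h3 : 0 ≤ sideSign c a p) : p ∈ convexHull ℝ B := by
  have hsum : sideSign a b p + sideSign b c p + sideSign c a p = sideSign a b c := by
    unfold sideSign; ring
  have key := (convex_convexHull ℝ B).sum_mem (t := (Finset.univ : Finset (Fin 3)))
    (w := ![sideSign b c p / sideSign a b c, sideSign c a p / sideSign a b c,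
      sideSign a b p / sideSign a b c]) (z := ![a, b, c])
    (by
      intro i _
      fin_cases i
      · exact div_nonneg h2 hS.le
      · exact div_nonneg h3 hS.le
      · exact div_nonneg h1 hS.le)
    (by
      rw [Fin.sum_univ_three]
      simp
      rw [← add_div, ← add_div, div_eq_one_iff_eq hS.ne']
      linarith)
    (by
      intro i _
      apply subset_convexHull
      fin_cases i
      · exact ha
      · exact hb
      · exact hc)
  rw [Fin.sum_univ_three] at key
  simp only [Matrix.cons_val_zero, Matrix.cons_val_one, Matrix.cons_val] at key
  convert key using 1
  have hS' := hS.ne'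
  ext
  · simp only [Prod.fst_add, Prod.smul_fst, smul_eq_mul]
    field_simp
    unfold sideSign; ring
  · simp only [Prod.snd_add, Prod.smul_snd, smul_eq_mul]
    field_simp
    unfold sideSign; ring

lemma tri_int {B : Set Pt} {a b c p : Pt} (ha : a ∈ B) (hb : b ∈ B) (hc : c ∈ B)
    (hS : 0 < sideSign a b c) (h1 : 0 < sideSign a b p) (h2 : 0 < sideSign b c p)
    (h3 : 0 < sideSign c a p) : p ∈ interior (convexHull ℝ B) := by
  have ho : IsOpen {q : Pt | 0 < sideSign a b q ∧ 0 < sideSign b c q ∧ 0 < sideSign c a q} :=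
    (isOpen_lt continuous_const (ss_cont a b)).inter
      ((isOpen_lt continuous_const (ss_cont b c)).inter
        (isOpen_lt continuous_const (ss_cont c a)))
  refine interior_maximal ?_ ho ⟨h1, h2, h3⟩
  rintro q ⟨k1, k2, k3⟩
  exact tri_mem ha hb hc hS k1.le k2.le k3.le

lemma poly_int {B : Set Pt} {v : ℕ → Pt} {M : ℕ} (hM : 3 ≤ M) (hv : CPoly v M)
    (hB : ∀ i, v i ∈ B) {o : Pt} (h : ∀ i < M, 0 < sideSign (v i) (v (i + 1)) o) :
    o ∈ interior (convexHull ℝ B) := by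
  have ho : IsOpen (⋂ i ∈ Finset.range M, {q : Pt | 0 < sideSign (v i) (v (i + 1)) q}) :=
    isOpen_biInter_finset fun i _ => isOpen_lt continuous_const (ss_cont _ _)
  refine interior_maximal ?_ ho (by simpa using h)
  intro q hq
  have hq' : ∀ i < M, 0 < sideSign (v i) (v (i + 1)) q := by simpa using hq
  have hlast : sideSign (v 0) (v (M - 1)) q < 0 := by
    have := hq' (M - 1) (by omega)
    rw [show M - 1 + 1 = 0 + M by omega, hv.1 0, ss_swap] at this
    linarith
  have hex : ∃ k, sideSign (v 0) (v (k + 1 + 1)) q ≤ 0 :=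
    ⟨M - 3, by rw [show M - 3 + 1 + 1 = M - 1 by omega]; exact hlast.le⟩
  classical
  obtain ⟨k, hk, hmin⟩ : ∃ k, sideSign (v 0) (v (k + 1 + 1)) q ≤ 0 ∧
      ∀ m < k, ¬ sideSign (v 0) (v (m + 1 + 1)) q ≤ 0 :=
    ⟨Nat.find hex, Nat.find_spec hex, fun m hm => Nat.find_min hex hm⟩
  have hkM : k ≤ M - 3 := by
    by_contra hcon
    apply hmin (M - 3) (by omega)
    rw [show M - 3 + 1 + 1 = M - 1 by omega]; exact hlast.le
  have hk1 : 0 < sideSign (v 0) (v (k + 1)) q := by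
    cases k with
    | zero => exact hq' 0 (by omega)
    | succ k => exact not_le.1 (hmin k (by omega))
  refine tri_mem (hB 0) (hB (k + 1)) (hB (k + 1 + 1)) (hv.2 _ _ _ (by omega) (by omega) (by omega))
    hk1.le (hq' (k + 1) (by omega)).le ?_
  rw [ss_swap]; linarith

lemma mk_poly {w : ℕ → Pt} {N : ℕ} (hN : 3 ≤ N)
    (h : ∀ i j k, i < j → j < k → k < N → 0 < sideSign (w i) (w j) (w k)) :
    CPoly (fun i => w (i % N)) N := by
  have hper : Function.Periodic (fun i => w (i % N)) N := by
    intro i; show w ((i + N) % N) = w (i % N); rw [Nat.add_mod_right]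
  refine ⟨hper, ?_⟩
  intro i j k h1 h2 h3
  show 0 < sideSign (w (i % N)) (w (j % N)) (w (k % N))
  have hi : i % N < N := Nat.mod_lt _ (by omega)
  have e : N * (i / N) + i % N = i := Nat.div_add_mod i N
  obtain ⟨q, hq⟩ : ∃ q, q = N * (i / N) := ⟨_, rfl⟩
  have hmod : ∀ m, (m + q) % N = m % N := fun m => by rw [hq]; exact Nat.add_mul_mod_self_left _ _ _
  rw [← hq] at e
  have ej : j % N = (j - q) % N := by rw [← hmod (j - q), Nat.sub_add_cancel (by omega)]
  have ek : k % N = (k - q) % N := by rw [← hmod (k - q), Nat.sub_add_cancel (by omega)]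
  rw [ej, ek]
  have big : ∀ m, N ≤ m → m < 2 * N → m % N = m - N := fun m h1 h2 => by
    rw [Nat.mod_eq_sub_mod h1, Nat.mod_eq_of_lt (by omega)]
  by_cases hj : j - q < N
  · rw [Nat.mod_eq_of_lt hj]
    by_cases hk : k - q < N
    · rw [Nat.mod_eq_of_lt hk]
      exact h _ _ _ (by omega) (by omega) hk
    · rw [big (k - q) (by omega) (by omega), ← ss_cyc]
      exact h _ _ _ (by omega) (by omega) (by omega)
  · rw [big (j - q) (by omega) (by omega), big (k - q) (by omega) (by omega), ss_cyc]
    exact h _ _ _ (by omega) (by omega) (by omega)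

theorem two_case {P : Set Pt} {φ : Pt → ℕ} {red blue : ℕ} (hG : Gen P) (hrb : red ≠ blue)
    {r1 r2 : Pt} (hr : r1 ≠ r2) (h1 : r1 ∈ P ∧ φ r1 = red) (h2 : r2 ∈ P ∧ φ r2 = red)
    {b1 b2 : Pt} (k1 : b1 ∈ P ∧ φ b1 = blue) (k2 : b2 ∈ P ∧ φ b2 = blue)
    (s1 : 0 < sideSign r1 r2 b1) (s2 : sideSign r1 r2 b2 < 0) :
    ∃ γ : ZMod (2 * 2) → Pt, IsPlaneCycle φ (2 * 2) γ ∧ ∀ i, γ i ∈ P := by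
  have hb : b1 ≠ b2 := by rintro rfl; linarith
  have hne : ∀ r b : Pt, φ r = red → φ b = blue → r ≠ b := by
    rintro r b h k rfl; exact hrb (h.symm.trans k)
  have n11 := hne _ _ h1.2 k1.2
  have n12 := hne _ _ h1.2 k2.2
  have n21 := hne _ _ h2.2 k1.2
  have n22 := hne _ _ h2.2 k2.2
  have f := aff_ss r1 r2
  have G1 : Good (r1, b2) (b1, r1) := sepGood hG f s1.ne' h1.1 k2.1 k1.1 h1.1 n12 n11.symm
    (by simp) s2.le s1.le (by simp) (by simp [hb.symm, n12.symm])
  have G2 : Good (r1, b2) (r2, b1) := sepGood hG f s1.ne' h1.1 k2.1 h2.1 k1.1 n12 n21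
    (by simp) s2.le (by simp) s1.le (by simp [hr, n11])
  have G3 : Good (b2, r2) (b1, r1) := sepGood hG f s1.ne' k2.1 h2.1 k1.1 h1.1 n22.symm n11.symm
    s2.le (by simp) s1.le (by simp) (by simp [hr.symm, n21])
  have G4 : Good (b2, r2) (r2, b1) := sepGood hG f s1.ne' k2.1 h2.1 h2.1 k1.1 n22.symm n21
    s2.le (by simp) (by simp) s1.le (by simp [n22.symm, hb.symm])
  have G5 : Good (r2, b1) (b1, r1) := adjGood hG h2.1 h1.1 k1.1 hr.symm n21.symm n11.symm
  have G6 : Good (r1, b2) (b2, r2) := adjGood hG h1.1 h2.1 k2.1 hr n12.symm n22.symm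
  refine cycle_of_list (t := 2) le_rfl [r1, b2, r2, b1] rfl ?_ b1 (by simp) ?_ ?_ ?_
  · simp [n12, hr, n11, n22.symm, hb.symm, n21]
  · intro e he e' he' hee
    simp at he he'
    rcases he with rfl | rfl | rfl | rfl <;> rcases he' with rfl | rfl | rfl | rfl <;>
      first
      | exact absurd rfl hee
      | assumption
      | (apply Good.symm; assumption)
  · intro e he
    simp at he
    rcases he with rfl | rfl | rfl | rfl <;>
      simp [h1.2, h2.2, k1.2, k2.2, hrb, hrb.symm]
  · intro p hp
    simp at hp
    rcases hp with rfl | rfl | rfl | rfl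
    exacts [h1.1, k2.1, h2.1, k1.1]

/-! ### extraction of the polygon -/

def akey (o p : Pt) : ℝ := (p.2 - o.2) / ((p.1 - o.1) + |p.2 - o.2|)

lemma akey_lt {o a b : Pt} (ha : o.1 ≤ a.1) (hb : o.1 ≤ b.1) (hao : a ≠ o) (hbo : b ≠ o)
    (h : 0 < sideSign o a b) : akey o a < akey o b := by
  have den : ∀ p : Pt, o.1 ≤ p.1 → p ≠ o → 0 < (p.1 - o.1) + |p.2 - o.2| := by
    intro p h1 h2
    by_contra hcon
    have h3 := abs_nonneg (p.2 - o.2)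
    have h4 : |p.2 - o.2| = 0 := by linarith
    have h5 : p.1 - o.1 = 0 := by linarith
    rw [abs_eq_zero] at h4
    exact h2 (Prod.ext (by linarith) (by linarith))
  unfold akey
  rw [div_lt_div_iff₀ (den a ha hao) (den b hb hbo)]
  unfold sideSign at h
  have ha' : 0 ≤ a.1 - o.1 := by linarith
  have hb' : 0 ≤ b.1 - o.1 := by linarith
  generalize a.1 - o.1 = x at *
  generalize a.2 - o.2 = y at *
  generalize b.1 - o.1 = z at *
  generalize b.2 - o.2 = w at *
  rcases le_or_gt 0 y with hy | hy <;> rcases le_or_gt 0 w with hw | hw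
  · rw [abs_of_nonneg hy, abs_of_nonneg hw]; nlinarith
  · nlinarith [mul_nonneg hy hb', mul_nonneg ha' (neg_nonneg.2 hw.le)]
  · rw [abs_of_neg hy, abs_of_nonneg hw]; nlinarith [mul_nonneg (neg_nonneg.2 hy.le) hw]
  · rw [abs_of_neg hy, abs_of_neg hw]; nlinarith

lemma extract {P : Set Pt} (hG : Gen P) (B : Finset Pt) (hBP : ∀ p ∈ B, p ∈ P)
    (hB3 : 3 ≤ B.card) (hout : ∀ p ∈ B, p ∉ interior (convexHull ℝ (B : Set Pt))) :
    ∃ v : ℕ → Pt, CPoly v B.card ∧ (∀ i, v i ∈ B) ∧ ∀ p ∈ B, ∃ i, v i = p := by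
  classical
  obtain ⟨o, ho, homin⟩ := Finset.exists_min_image B (fun p => p.1)
    (Finset.card_pos.1 (by omega))
  have hlt : ∀ a ∈ B.erase o, ∀ b ∈ B.erase o, 0 < sideSign o a b → akey o a < akey o b := by
    intro a ha b hb h
    rw [Finset.mem_erase] at ha hb
    exact akey_lt (homin a ha.2) (homin b hb.2) ha.1 hb.1 h
  have htri : ∀ a ∈ B.erase o, ∀ b ∈ B.erase o, a ≠ b →
      0 < sideSign o a b ∨ 0 < sideSign o b a := by
    intro a ha b hb hab
    rw [Finset.mem_erase] at ha hb
    have := hG o (hBP _ ho) a (hBP _ ha.2) b (hBP _ hb.2) ha.1.symm hb.1.symm hab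
    rcases lt_or_gt_of_ne this with h | h
    · right; rw [ss_swap']; linarith
    · exact Or.inl h
  have hpos : ∀ a ∈ B.erase o, ∀ b ∈ B.erase o, akey o a < akey o b → 0 < sideSign o a b := by
    intro a ha b hb h
    have hab : a ≠ b := by rintro rfl; exact lt_irrefl _ h
    rcases htri a ha b hb hab with h' | h'
    · exact h'
    · exact absurd (hlt b hb a ha h') (not_lt.2 h.le)
  have hinj : Set.InjOn (akey o) (B.erase o : Finset Pt) := by
    intro a ha b hb h
    by_contra hab
    rcases htri a ha b hb hab with h' | h'
    · exact absurd (hlt a ha b hb h') (by rw [h]; exact lt_irrefl _)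
    · exact absurd (hlt b hb a ha h') (by rw [h]; exact lt_irrefl _)
  have hKc : ((B.erase o).image (akey o)).card = B.card - 1 := by
    rw [Finset.card_image_of_injOn hinj, Finset.card_erase_of_mem ho]
  let em := ((B.erase o).image (akey o)).orderEmbOfFin hKc
  have hem : ∀ i, ∃ b ∈ B.erase o, akey o b = em i := fun i =>
    Finset.mem_image.1 (Finset.orderEmbOfFin_mem _ hKc i)
  choose u hu1 hu2 using hem
  have husurj : ∀ p ∈ B.erase o, ∃ i, u i = p := by
    intro p hp
    have : akey o p ∈ Set.range em := by
      rw [Finset.range_orderEmbOfFin]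
      exact Finset.mem_coe.2 (Finset.mem_image_of_mem _ hp)
    obtain ⟨i, hi⟩ := this
    exact ⟨i, hinj (hu1 i) hp ((hu2 i).trans hi)⟩
  have hupos : ∀ i j, i < j → 0 < sideSign o (u i) (u j) := by
    intro i j hij
    apply hpos _ (hu1 i) _ (hu1 j)
    rw [hu2, hu2]
    exact em.strictMono hij
  let w : ℕ → Pt := fun n => if h : 1 ≤ n ∧ n - 1 < B.card - 1 then u ⟨n - 1, h.2⟩ else o
  have hw0 : w 0 = o := by simp [w]
  have hwS : ∀ n (h1 : 1 ≤ n) (h : n < B.card), w n = u ⟨n - 1, by omega⟩ := by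
    intro n h1 h
    have : 1 ≤ n ∧ n - 1 < B.card - 1 := ⟨h1, by omega⟩
    simp only [w, this, dif_pos, and_self]
  have hwB : ∀ n, w n ∈ B := by
    intro n
    simp only [w]
    split_ifs with h
    · exact Finset.mem_of_mem_erase (hu1 _)
    · exact ho
  have hw0pos : ∀ j k, 0 < j → j < k → k < B.card → 0 < sideSign (w 0) (w j) (w k) := by
    intro j k h1 h2 h3
    rw [hw0, hwS j (by omega) (by omega), hwS k (by omega) h3]
    exact hupos _ _ (by simp; omega)
  have hwpos : ∀ i j k, i < j → j < k → k < B.card → 0 < sideSign (w i) (w j) (w k) := by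
    intro i j k h1 h2 h3
    by_cases hi : i = 0
    · subst hi; exact hw0pos j k h1 h2 h3
    by_contra hcon
    have a1 := hw0pos i k (by omega) (by omega) h3
    have a2 := hw0pos i j (by omega) h1 (by omega)
    have a3 := hw0pos j k (by omega) h2 h3
    have nij : w i ≠ w j := by intro h; rw [h] at a2; simp at a2
    have nik : w i ≠ w k := by intro h; rw [h] at a1; simp at a1
    have njk : w j ≠ w k := by intro h; rw [h] at a3; simp at a3
    have hne := hG _ (hBP _ (hwB i)) _ (hBP _ (hwB j)) _ (hBP _ (hwB k)) nij nik njk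
    have hneg : sideSign (w i) (w j) (w k) < 0 := lt_of_le_of_ne (not_lt.1 hcon) hne
    apply hout (w j) (hwB j)
    refine tri_int (Finset.mem_coe.2 (hwB 0)) (Finset.mem_coe.2 (hwB i))
      (Finset.mem_coe.2 (hwB k)) a1 a2 ?_ ?_
    · rw [ss_swap']; linarith
    · rw [ss_cyc]; exact a3
  refine ⟨_, mk_poly hB3 hwpos, fun i => hwB _, ?_⟩
  intro p hp
  by_cases hpo : p = o
  · exact ⟨0, by simp [hw0, hpo]⟩
  · obtain ⟨i, hi⟩ := husurj p (Finset.mem_erase.2 ⟨hpo, hp⟩)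
    refine ⟨i + 1, ?_⟩
    have := i.2
    show w ((i + 1) % B.card) = p
    rw [Nat.mod_eq_of_lt (by omega), hwS _ (by omega) (by omega), ← hi]
    rfl

/-! ### deleting vertices -/

def Mono1 (v : ℕ → Pt) (M : ℕ) (R : Finset Pt) : Prop :=
  ∀ r ∈ R, ∀ i j k, i < j → j < k → k < i + M → sideSign (v i) (v j) r < 0 →
    sideSign (v i) (v k) r < 0

def Few (v : ℕ → Pt) (R : Finset Pt) : Prop :=
  ∀ i, ∀ r ∈ R, ∀ r' ∈ R, sideSign (v i) (v (i + 1)) r < 0 →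
    sideSign (v i) (v (i + 1)) r' < 0 → r = r'

lemma mono_init {v : ℕ → Pt} {M : ℕ} {R : Finset Pt} (hv : CPoly v M)
    (h : ∀ r ∈ R, ∀ i, 0 < sideSign (v i) (v (i + 1)) r) : Mono1 v M R := by
  intro r hr i j k h1 h2 h3 hneg
  have hj : i + 1 < j := by
    by_contra hcon
    have : j = i + 1 := by omega
    subst this
    linarith [h r hr i]
  have a1 := hv.pos hj (by omega)
  have a2 := hv.pos (i := i) (k := k) (by omega) h3
  have a3 := hv.2 i j k h1 h2 h3
  have a4 := h r hr i
  have key : sideSign (v i) (v (i + 1)) (v j) * sideSign (v i) (v k) r =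
      sideSign (v i) (v (i + 1)) (v k) * sideSign (v i) (v j) r -
      sideSign (v i) (v (i + 1)) r * sideSign (v i) (v j) (v k) := by
    unfold sideSign; ring
  have b1 := mul_neg_of_pos_of_neg a2 hneg
  have b2 := mul_pos a4 a3
  by_contra hcon
  have := mul_nonneg a1.le (not_lt.1 hcon)
  linarith

lemma per_mul {v : ℕ → Pt} {M : ℕ} (h : Function.Periodic v M) (n q : ℕ) :
    v (n + q * M) = v n := h.nat_mul q n

lemma chord_two {v : ℕ → Pt} {M : ℕ} {R : Finset Pt} (hM : 4 ≤ M) (hv : CPoly v M)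
    (hm : Mono1 v M R) {r : Pt} (hr : r ∈ R) :
    ((Finset.range M).filter (fun k => sideSign (v k) (v (k + 2)) r < 0)).card ≤ 2 := by
  by_contra hcon
  rw [not_le, Finset.two_lt_card] at hcon
  obtain ⟨a, ha, b, hb, c, hc, hab, hac, hbc⟩ := hcon
  simp only [Finset.mem_filter, Finset.mem_range] at ha hb hc
  have pair : ∀ x y, x < M → y < M → sideSign (v x) (v (x + 2)) r < 0 →
      sideSign (v y) (v (y + 2)) r < 0 → x < y → y = x + 1 ∨ y = x + (M - 1) := by
    intro x y hx hy nx ny hxy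
    by_contra hcon
    have h1 : sideSign (v x) (v y) r < 0 := by
      by_cases h : y = x + 2
      · rw [h]; exact nx
      · exact hm r hr x (x + 2) y (by omega) (by omega) (by omega) nx
    have h2 : sideSign (v y) (v (x + M)) r < 0 := by
      by_cases h : x + M = y + 2
      · rw [h]; exact ny
      · exact hm r hr y (y + 2) (x + M) (by omega) (by omega) (by omega) ny
    rw [hv.1 x, ss_swap] at h2
    linarith
  have p1 := pair a b ha.1 hb.1 ha.2 hb.2
  have p2 := pair b a hb.1 ha.1 hb.2 ha.2
  have p3 := pair a c ha.1 hc.1 ha.2 hc.2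
  have p4 := pair c a hc.1 ha.1 hc.2 ha.2
  have p5 := pair b c hb.1 hc.1 hb.2 hc.2
  have p6 := pair c b hc.1 hb.1 hc.2 hb.2
  omega

lemma good_chord {v : ℕ → Pt} {M : ℕ} {R : Finset Pt} (hM : 4 ≤ M) (hv : CPoly v M)
    (hm : Mono1 v M R) (hR : R.card < M) : ∃ k, ∀ r ∈ R, ∀ r' ∈ R,
      sideSign (v k) (v (k + 2)) r < 0 → sideSign (v k) (v (k + 2)) r' < 0 → r = r' := by
  classical
  by_contra hcon
  push Not at hcon
  have h2 : ∀ k ∈ Finset.range M, 2 ≤ (R.filter (fun r => sideSign (v k) (v (k + 2)) r < 0)).card := by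
    intro k _
    obtain ⟨r, hr, r', hr', n1, n2, hne⟩ := hcon k
    exact Finset.one_lt_card.2 ⟨r, by simp [hr, n1], r', by simp [hr', n2], hne⟩
  have h3 := Finset.sum_card_bipartiteAbove_eq_sum_card_bipartiteBelow
    (s := Finset.range M) (t := R) (fun k r => sideSign (v k) (v (k + 2)) r < 0)
  have h4 := Finset.card_nsmul_le_sum _ _ 2 h2
  have h5 := Finset.sum_le_card_nsmul R
    (fun r => ((Finset.range M).filter (fun k => sideSign (v k) (v (k + 2)) r < 0)).card) 2
    (fun r hr => chord_two hM hv hm hr)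
  simp only [Finset.bipartiteAbove, Finset.bipartiteBelow] at h3
  simp only [Finset.card_range, smul_eq_mul] at h4 h5
  omega

lemma delete_one {v : ℕ → Pt} {M : ℕ} {R : Finset Pt} (hM : 4 ≤ M) (hv : CPoly v M)
    (hm : Mono1 v M R) (hf : Few v R) (hR : R.card < M) :
    ∃ s : ℕ → ℕ, CPoly (v ∘ s) (M - 1) ∧ Mono1 (v ∘ s) (M - 1) R ∧ Few (v ∘ s) R := by
  obtain ⟨k, hk⟩ := good_chord hM hv hm hR
  let s : ℕ → ℕ := fun n => n + n / (M - 1) + (k + 2)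
  have hM1 : 0 < M - 1 := by omega
  have hs1 : StrictMono s := by
    intro a b hab
    have := Nat.div_le_div_right (c := M - 1) hab.le
    simp only [s]; omega
  have hsper : ∀ n, s (n + (M - 1)) = s n + M := by
    intro n
    simp only [s]
    rw [Nat.add_div_right _ hM1]; omega
  have hlt : ∀ i k, k < i + (M - 1) → s k < s i + M := by
    intro i k h
    rw [← hsper]; exact hs1 h
  refine ⟨s, ⟨?_, ?_⟩, ?_, ?_⟩
  · intro n
    simp only [Function.comp]
    rw [hsper]; exact hv.1 _
  · intro a b c h1 h2 h3
    exact hv.2 _ _ _ (hs1 h1) (hs1 h2) (hlt _ _ h3)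
  · intro r hr a b c h1 h2 h3
    exact hm r hr _ _ _ (hs1 h1) (hs1 h2) (hlt _ _ h3)
  · intro i r hr r' hr'
    simp only [Function.comp]
    by_cases hd : (M - 1) ∣ (i + 1)
    · obtain ⟨q, hq⟩ := hd
      have hq0 : q ≠ 0 := by rintro rfl; simp at hq
      obtain ⟨q', rfl⟩ := Nat.exists_eq_succ_of_ne_zero hq0
      have hMM : M - 1 + 1 = M := by omega
      have e0 : i = (M - 2) + (M - 1) * q' := by
        rw [Nat.mul_succ] at hq; omega
      have d1 : i / (M - 1) = q' := by
        rw [e0, Nat.add_mul_div_left _ _ hM1, Nat.div_eq_of_lt (by omega), zero_add]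
      have d2 : (i + 1) / (M - 1) = q' + 1 := by
        rw [hq, Nat.mul_div_cancel_left _ hM1]
      have e3 : (q' + 1) * M = (M - 1) * q' + q' + M := by
        conv_lhs => rw [← hMM]
        conv_rhs => rw [show (M - 1) * q' + q' + M = (M - 1) * q' + q' + (M - 1 + 1) by omega]
        ring
      have e1 : s i = k + (q' + 1) * M := by
        simp only [s]; rw [d1, e3]; omega
      have e2 : s (i + 1) = (k + 2) + (q' + 1) * M := by
        simp only [s]; rw [d2, e3]; omega
      rw [e1, e2, per_mul hv.1, per_mul hv.1]
      exact hk r hr r' hr'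
    · have e2 : s (i + 1) = s i + 1 := by
        simp only [s]
        rw [Nat.succ_div_of_not_dvd hd]; omega
      rw [e2]
      exact hf _ r hr r' hr'

lemma delete_many {R : Finset Pt} (hR3 : 3 ≤ R.card) : ∀ d : ℕ, ∀ v : ℕ → Pt,
    CPoly v (R.card + d) → Mono1 v (R.card + d) R → Few v R →
    ∃ s : ℕ → ℕ, CPoly (v ∘ s) R.card ∧ Mono1 (v ∘ s) R.card R ∧ Few (v ∘ s) R := by
  intro d
  induction d with
  | zero => intro v h1 h2 h3; exact ⟨id, h1, h2, h3⟩
  | succ d ih =>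
    intro v h1 h2 h3
    obtain ⟨s, k1, k2, k3⟩ := delete_one (by omega) h1 h2 h3 (by omega)
    rw [show R.card + (d + 1) - 1 = R.card + d by omega] at k1 k2
    obtain ⟨s', l1, l2, l3⟩ := ih _ k1 k2 k3
    exact ⟨s ∘ s', l1, l2, l3⟩

lemma mono_H1 {P : Set Pt} {v : ℕ → Pt} {M : ℕ} {R : Finset Pt} (hG : Gen P) (hM : 3 ≤ M)
    (hv : CPoly v M) (hvP : ∀ i, v i ∈ P) (hRP : ∀ r ∈ R, r ∈ P ∧ ∀ i, r ≠ v i)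
    (hm : Mono1 v M R) : ∀ r ∈ R, (∀ j < M, 0 < sideSign (v j) (v (j + 1)) r) ∨
      ∃ i < M, sideSign (v i) (v (i + 1)) r < 0 ∧
        ∀ j < M, j ≠ i → 0 < sideSign (v j) (v (j + 1)) r := by
  intro r hr
  have hne : ∀ i, sideSign (v i) (v (i + 1)) r ≠ 0 := fun i =>
    hG _ (hvP _) _ (hvP _) _ (hRP r hr).1 (hv.ne hM (by omega) (by omega))
      ((hRP r hr).2 _).symm ((hRP r hr).2 _).symm
  have pair : ∀ i j, i < j → j < M → sideSign (v i) (v (i + 1)) r < 0 →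
      sideSign (v j) (v (j + 1)) r < 0 → False := by
    intro i j hij hj ni nj
    have h1 : sideSign (v i) (v j) r < 0 := by
      by_cases h : j = i + 1
      · rw [h]; exact ni
      · exact hm r hr i (i + 1) j (by omega) (by omega) (by omega) ni
    have h2 : sideSign (v j) (v (i + M)) r < 0 := by
      by_cases h : i + M = j + 1
      · rw [h]; exact nj
      · exact hm r hr j (j + 1) (i + M) (by omega) (by omega) (by omega) nj
    rw [hv.1 i, ss_swap] at h2
    linarith
  by_cases h : ∃ i < M, sideSign (v i) (v (i + 1)) r < 0
  · obtain ⟨i, hi, hneg⟩ := h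
    refine Or.inr ⟨i, hi, hneg, fun j hj hji => ?_⟩
    rcases lt_or_gt_of_ne (hne j) with h | h
    · rcases lt_or_gt_of_ne hji with h' | h'
      · exact (pair j i h' hi h hneg).elim
      · exact (pair i j h' hj hneg h).elim
    · exact h
  · push Not at h
    exact Or.inl fun j hj => lt_of_le_of_ne (h j hj) (hne j).symm

/-- let `H` be a geometric complete bipartite graph with `n` red and `n` blue
vertices. If there is a set `B` of blue vertices whose convex hull interior contains all red
vertices and no blue vertex, then for each `t` with `2 ≤ t ≤ n`, `H` contains a plane cycle
of length `2t`. -/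
theorem stmt_8 (P : Set Pt) (φ : Pt → ℕ) (hfin : P.Finite) (hgp : GenPos P)
    (n : ℕ) (red blue : ℕ) (hrb : red ≠ blue)
    (hcover : ∀ p ∈ P, φ p = red ∨ φ p = blue)
    (hR : {p ∈ P | φ p = red}.ncard = n) (hB : {p ∈ P | φ p = blue}.ncard = n)
    (B : Set Pt) (hBsub : B ⊆ {p ∈ P | φ p = blue})
    (hRin : ∀ p ∈ P, φ p = red → p ∈ interior (convexHull ℝ B))
    (hBout : ∀ p ∈ P, φ p = blue → p ∉ interior (convexHull ℝ B)) :
    ∀ t : ℕ, 2 ≤ t → t ≤ n →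
      ∃ γ : ZMod (2 * t) → Pt, IsPlaneCycle φ (2 * t) γ ∧ ∀ i, γ i ∈ P := by
  classical
  intro t ht2 htn
  have hG := gen_of_genPos hgp
  have hfR : {p ∈ P | φ p = red}.Finite := hfin.subset fun p hp => hp.1
  have hfB : {p ∈ P | φ p = blue}.Finite := hfin.subset fun p hp => hp.1
  obtain ⟨Bl, hBl⟩ := hfB.exists_finset_coe
  obtain ⟨Re, hRe⟩ := hfR.exists_finset_coe
  obtain ⟨Bf, rfl⟩ := (hfB.subset hBsub).exists_finset_coe
  rw [← hRe, Set.ncard_coe_finset] at hR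
  rw [← hBl, Set.ncard_coe_finset] at hB
  obtain ⟨R, hRsub, hRt⟩ := Finset.exists_subset_card_eq (s := Re) (n := t) (by omega)
  have hRP : ∀ r ∈ R, r ∈ P ∧ φ r = red := by
    intro r hr
    have h1 : r ∈ (Re : Set Pt) := Finset.mem_coe.2 (hRsub hr)
    rw [hRe] at h1
    exact h1
  have hBP : ∀ p ∈ Bf, p ∈ P ∧ φ p = blue := fun p hp => hBsub (Finset.mem_coe.2 hp)
  obtain ⟨r1, hr1, r2, hr2, hr12⟩ := Finset.one_lt_card.1 (show 1 < R.card by omega)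
  have hin : ∀ r ∈ R, r ∈ interior (convexHull ℝ (Bf : Set Pt)) := fun r hr =>
    hRin r (hRP r hr).1 (hRP r hr).2
  have hrbne : ∀ r ∈ R, ∀ b, φ b = blue → r ≠ b := by
    rintro r hr b hb rfl
    exact hrb ((hRP r hr).2.symm.trans hb)
  by_cases ht : t = 2
  · subst ht
    obtain ⟨b1, hb1, s1⟩ := int_ss (hin r1 hr1) hr12
    obtain ⟨b2, hb2, s2⟩ := int_ss (hin r1 hr1) hr12.symm
    rw [ss_left] at s1
    rw [ss_right, ss_swap] at s2
    exact two_case hG hrb hr12 (hRP _ hr1) (hRP _ hr2) (hBP _ hb1) (hBP _ hb2) s1 (by linarith)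
  have ht3 : 3 ≤ t := by omega
  have hB3 : 3 ≤ Bf.card := by
    by_contra hcon
    have h012 : Bf.card = 0 ∨ Bf.card = 1 ∨ Bf.card = 2 := by omega
    rcases h012 with h | h | h
    · rw [Finset.card_eq_zero] at h
      exact not_two (hin r1 hr1) hr12 (by simp [h])
    · obtain ⟨x, hx⟩ := Finset.card_eq_one.1 h
      have hxb := (hBP x (by simp [hx])).2
      exact not_two (hin r1 hr1) (hrbne r1 hr1 x hxb) (by simp [hx])
    · obtain ⟨x, y, hxy, hx⟩ := Finset.card_eq_two.1 h
      exact not_two (hin r1 hr1) hxy (by simp [hx])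
  obtain ⟨v, hv, hvB, hvsurj⟩ := extract hG Bf (fun p hp => (hBP p hp).1) hB3
    (fun p hp => hBout p (hBP p hp).1 (hBP p hp).2)
  have hvP : ∀ i, v i ∈ P ∧ φ (v i) = blue := fun i => hBP _ (hvB i)
  have hpos : ∀ r ∈ R, ∀ i, 0 < sideSign (v i) (v (i + 1)) r := by
    intro r hr i
    have hne : v i ≠ v (i + 1) := hv.ne hB3 (by omega) (by omega)
    obtain ⟨q, hq, hlt⟩ := int_ss (hin r hr) hne.symm
    obtain ⟨k, rfl⟩ := hvsurj q hq
    have := hv.nonneg hB3 i k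
    rw [ss_swap, ss_swap (v (i + 1)) (v i) (v k)] at hlt
    linarith
  rcases le_or_gt Bf.card t with hMt | hMt
  · have hsubB : Bf ⊆ Bl := by
      intro p hp
      have : p ∈ (Bl : Set Pt) := by rw [hBl]; exact hBP p hp
      exact Finset.mem_coe.1 this
    have hcd : (Bl \ Bf).card = n - Bf.card := by
      rw [Finset.card_sdiff_of_subset hsubB, hB]
    obtain ⟨O, hOsub, hOc⟩ := Finset.exists_subset_card_eq (s := Bl \ Bf) (n := t - Bf.card)
      (by omega)
    have hOP : ∀ o ∈ O, (o ∈ P ∧ φ o = blue) ∧ o ∉ Bf := by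
      intro o ho
      have h1 := Finset.mem_sdiff.1 (hOsub ho)
      have h2 : o ∈ (Bl : Set Pt) := Finset.mem_coe.2 h1.1
      rw [hBl] at h2
      exact ⟨h2, h1.2⟩
    have := core hG hrb hB3 hv hvP R O hRP (fun o ho => (hOP o ho).1) (by omega)
      (fun r hr => Or.inl fun j _ => hpos r hr j)
      (fun i _ r hr r' _ h => by linarith [hpos r hr i])
      (Or.inr fun r hr j _ => hpos r hr j) ?_
    · rw [hRt] at this
      exact this
    · intro o ho
      by_contra hcon
      push Not at hcon
      obtain ⟨h1, h2⟩ := hOP o ho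
      apply hBout o h1.1 h1.2
      refine poly_int hB3 hv (fun i => Finset.mem_coe.2 (hvB i)) fun i hi => ?_
      refine lt_of_le_of_ne (hcon i hi) (Ne.symm ?_)
      refine hG _ (hvP _).1 _ (hvP _).1 _ h1.1 (hv.ne hB3 (by omega) (by omega)) ?_ ?_
      · intro h; exact h2 (h ▸ hvB i)
      · intro h; exact h2 (h ▸ hvB (i + 1))
  · have hd : Bf.card = R.card + (Bf.card - t) := by omega
    have hmono := mono_init hv hpos
    have hv' := hv
    rw [hd] at hv' hmono
    obtain ⟨s, k1, k2, k3⟩ := delete_many (by omega) _ v hv' hmono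
      (fun i r hr r' _ h => by linarith [hpos r hr i])
    have hR3 : 3 ≤ R.card := by omega
    have := core hG hrb hR3 k1 (fun i => hvP _) R ∅ hRP (by simp) (by simp)
      (mono_H1 hG hR3 k1 (fun i => (hvP _).1)
        (fun r hr => ⟨(hRP r hr).1, fun i => hrbne r hr _ (hvP _).2⟩) k2)
      (fun i _ => k3 i) (Or.inl rfl) (by simp)
    rw [hRt] at this
    exact this
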